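/- arXiv:1212.5971 — 3 statements merged into one kernel-verified Lean document; each statement's English description precedes it below -/
import Mathlib

section
/- For every real number q with 0 < q < 1, the following identity (traceable to Ramanujan) holds: q^{−1/72} · ∏_{n=0}^∞ 1/((1 − q^{(6n+1)/6})(1 − q^{(6n+5)/6})) = χ_{2,5}^{1,2}(q^{1/3}) · χ_{2,5}^{1,2}(q^{1/2}) + χ_{2,5}^{1,1}(q^{1/3}) · χ_{2,5}^{1,1}(q^{1/2}). -/
open scoped BigOperators

/-- The Euler product `(q)_∞ = ∏_{i=1}^∞ (1 - q^i)`. -/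
noncomputable def eulerProd (q : ℝ) : ℝ := ∏' i : ℕ, (1 - q ^ (i + 1))

/-- The Virasoro minimal model character `χ_{s,t}^{m,n}(q)`:
`q^(h - c/24) · (q)_∞⁻¹ · Σ_{k∈ℤ} q^(s t k²) (q^(k(mt-ns)) - q^((mt+ns)k+mn))`,
where `c = 1 - 6(s-t)²/(st)` and `h = ((mt-ns)² - (s-t)²)/(4st)`. -/
noncomputable def minChar (s t m n : ℤ) (q : ℝ) : ℝ :=
  q ^ ((((((m * t - n * s) ^ 2 - (s - t) ^ 2 : ℤ) : ℝ)) / (4 * (s : ℝ) * (t : ℝ))) -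
        (1 - 6 * ((s : ℝ) - (t : ℝ)) ^ 2 / ((s : ℝ) * (t : ℝ))) / 24) *
    (eulerProd q)⁻¹ *
    ∑' k : ℤ, ((q ^ (s * t * k ^ 2 + k * (m * t - n * s)) : ℝ) -
               (q ^ (s * t * k ^ 2 + (m * t + n * s) * k + m * n) : ℝ))

open Filter Topology

/-- A real series over `ℤ` whose terms are powers of `y ∈ (0,1)` with exponents growing at least
linearly converges. -/
lemma summable_zpow_of_abs_le {y : ℝ} (hy0 : 0 < y) (hy1 : y < 1) (e : ℤ → ℤ) (C : ℤ)
    (he : ∀ n, |n| ≤ e n + C) : Summable fun n : ℤ ↦ y ^ e n := by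
  have key : ∀ s : ℕ → ℤ, (∀ n, |s n| = n) → Summable fun n : ℕ ↦ y ^ e (s n) := by
    intro s hs
    refine Summable.of_nonneg_of_le (fun n ↦ (zpow_pos hy0 _).le) (fun n ↦ ?_)
      ((summable_geometric_of_lt_one hy0.le hy1).mul_left (y ^ (-C)))
    rw [← zpow_natCast, ← zpow_add₀ hy0.ne']
    refine zpow_le_zpow_right_of_le_one₀ hy0 hy1.le ?_
    have := he (s n)
    rw [hs] at this
    omega
  exact Summable.of_nat_of_neg (key (fun n ↦ n) (by simp)) (key (fun n ↦ -n) (by simp))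

/-- The general term of the double series `∑ (-1)ⁿ y^(m² + m + 6 n²)`. -/
noncomputable def thetaTerm (y : ℝ) (m n : ℤ) : ℝ := (-1) ^ n * y ^ (m ^ 2 + m + 6 * n ^ 2)

lemma summable_quadratic {y : ℝ} (hy0 : 0 < y) (hy1 : y < 1) (a b : ℤ) (ha : 0 < a) :
    Summable fun n : ℤ ↦ y ^ (a * n ^ 2 + b * n) := by
  refine summable_zpow_of_abs_le hy0 hy1 _ ((|b| + 1) ^ 2) fun n ↦ ?_
  have h1 : -(|b| * |n|) ≤ b * n := by rw [← abs_mul]; exact neg_abs_le _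
  have h2 : n ^ 2 ≤ a * n ^ 2 := le_mul_of_one_le_left (sq_nonneg n) ha
  nlinarith [sq_nonneg (|b| + 1 - |n|), sq_abs n, abs_nonneg b, abs_nonneg n]

lemma summable_alternating_quadratic {y : ℝ} (hy0 : 0 < y) (hy1 : y < 1) (a b : ℤ) (ha : 0 < a) :
    Summable fun n : ℤ ↦ ‖(-1 : ℝ) ^ n * y ^ (a * n ^ 2 + b * n)‖ := by
  simpa [abs_of_pos hy0] using summable_quadratic hy0 hy1 a b ha

lemma neg_one_zpow_sub_two_mul (a b : ℤ) : (-1 : ℝ) ^ (a - 2 * b) = (-1) ^ a := by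
  rw [zpow_sub₀ (by norm_num), zpow_mul]; simp

lemma thetaTerm_reflect (y : ℝ) (m n : ℤ) : thetaTerm y (-1 - m) (-n) = thetaTerm y m n := by
  unfold thetaTerm
  congr 1
  · simp [zpow_neg, ← inv_zpow]
  · congr 1; ring

lemma hasSum_thetaTerm {y : ℝ} (hy0 : 0 < y) (hy1 : y < 1) :
    HasSum (fun p : ℤ × ℤ ↦ thetaTerm y p.1 p.2)
      ((∑' m : ℤ, y ^ (m ^ 2 + m)) * ∑' n : ℤ, (-1) ^ n * y ^ (6 * n ^ 2)) := by
  have h1 : Summable fun m : ℤ ↦ ‖y ^ (m ^ 2 + m)‖ := by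
    simpa [abs_of_pos hy0] using summable_quadratic hy0 hy1 1 1 one_pos
  have h2 : Summable fun n : ℤ ↦ ‖(-1 : ℝ) ^ n * y ^ (6 * n ^ 2)‖ := by
    simpa using summable_alternating_quadratic hy0 hy1 6 0 (by norm_num)
  rw [tsum_mul_tsum_of_summable_norm h1 h2]
  have h : (fun p : ℤ × ℤ ↦ thetaTerm y p.1 p.2) =
      fun p ↦ y ^ (p.1 ^ 2 + p.1) * ((-1) ^ p.2 * y ^ (6 * p.2 ^ 2)) := by
    funext p
    rw [thetaTerm, zpow_add₀ hy0.ne']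
    ring
  rw [h]
  exact (summable_mul_of_summable_norm h1 h2).hasSum

/-- The sum of `thetaTerm` over the coset `m ≡ 2 n + i` modulo `5`. -/
noncomputable def thetaCoset (y : ℝ) (i : ℤ) : ℝ :=
  ∑' p : ℤ × ℤ, thetaTerm y (2 * p.1 + 5 * p.2 + i) p.1

lemma sum_thetaCoset {y : ℝ} (hy0 : 0 < y) (hy1 : y < 1) :
    ∑ i : Fin 5, thetaCoset y (i : ℕ) =
      (∑' m : ℤ, y ^ (m ^ 2 + m)) * ∑' n : ℤ, (-1) ^ n * y ^ (6 * n ^ 2) := by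
  let e : Fin 5 × (ℤ × ℤ) ≃ ℤ × ℤ :=
    { toFun := fun x ↦ (2 * x.2.1 + 5 * x.2.2 + (x.1 : ℕ), x.2.1)
      invFun := fun p ↦ (((Int.divModEquiv 5) (p.1 - 2 * p.2)).2,
        (p.2, ((Int.divModEquiv 5) (p.1 - 2 * p.2)).1))
      left_inv := by
        rintro ⟨i, n, j⟩
        have : 2 * n + 5 * j + ((i : ℕ) : ℤ) - 2 * n = (Int.divModEquiv 5).symm (j, i) := by
          simp [Int.divModEquiv]; ring
        simp only [this, Equiv.apply_symm_apply]
      right_inv := by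
        rintro ⟨m, n⟩
        have := (Int.divModEquiv 5).symm_apply_apply (m - 2 * n)
        rw [Int.divModEquiv_symm_apply] at this
        push_cast at this
        ext
        · dsimp only
          linarith
        · rfl }
  have h := e.hasSum_iff.mpr (hasSum_thetaTerm hy0 hy1)
  rw [← h.tsum_eq, h.summable.tsum_prod, tsum_fintype]
  rfl

lemma thetaCoset_reflect (y : ℝ) (i : ℤ) : thetaCoset y (4 - i) = thetaCoset y i := by
  let e : ℤ × ℤ ≃ ℤ × ℤ := (Equiv.neg ℤ).prodCongr (Equiv.subLeft (-1))
  unfold thetaCoset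
  rw [← e.tsum_eq]
  refine tsum_congr fun p ↦ ?_
  rw [← thetaTerm_reflect]
  simp only [e, Equiv.prodCongr_apply, Prod.map, Equiv.neg_apply, Equiv.subLeft_apply]
  congr 1 <;> ring

lemma thetaCoset_two (y : ℝ) : thetaCoset y 2 = 0 := by
  let e : ℤ × ℤ ≃ ℤ × ℤ :=
    { toFun := fun p ↦ (-p.1 - (2 * p.2 + 1), p.2)
      invFun := fun p ↦ (-p.1 - (2 * p.2 + 1), p.2)
      left_inv := fun p ↦ by ext <;> simp
      right_inv := fun p ↦ by ext <;> simp }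
  have h : thetaCoset y 2 = -thetaCoset y 2 := by
    conv_lhs => unfold thetaCoset
    rw [← e.tsum_eq, thetaCoset, ← tsum_neg]
    refine tsum_congr fun p ↦ ?_
    simp only [e, Equiv.coe_fn_mk, thetaTerm]
    rw [← neg_mul]
    congr 1
    · rw [← sub_sub, zpow_sub_one₀ (by norm_num), neg_one_zpow_sub_two_mul, zpow_neg,
        ← inv_zpow]
      norm_num
    · congr 1; ring
  linarith

lemma thetaCoset_eq_mul {y : ℝ} (hy0 : 0 < y) (hy1 : y < 1) (i : ℤ) :
    thetaCoset y i = y ^ (i ^ 2 + i) *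
      ((∑' k : ℤ, (-1) ^ k * y ^ (10 * k ^ 2 + (4 * i + 2) * k)) *
        ∑' l : ℤ, (-1) ^ l * y ^ (15 * l ^ 2 + (6 * i + 3) * l)) := by
  let e : ℤ × ℤ ≃ ℤ × ℤ :=
    { toFun := fun p ↦ (p.1 - p.2, p.2)
      invFun := fun p ↦ (p.1 + p.2, p.2)
      left_inv := fun p ↦ by ext <;> simp
      right_inv := fun p ↦ by ext <;> simp }
  rw [tsum_mul_tsum_of_summable_norm
    (summable_alternating_quadratic hy0 hy1 _ _ (by norm_num))
    (summable_alternating_quadratic hy0 hy1 _ _ (by norm_num)), ← tsum_mul_left, thetaCoset,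
    ← e.tsum_eq]
  refine tsum_congr fun p ↦ ?_
  simp only [e, Equiv.coe_fn_mk, thetaTerm]
  have h : (-1 : ℝ) ^ (p.1 - p.2) = (-1) ^ p.1 * (-1) ^ p.2 := by
    rw [← zpow_add₀ (by norm_num), ← neg_one_zpow_sub_two_mul (p.1 + p.2) p.2]
    congr 1; ring
  rw [h, mul_mul_mul_comm, mul_left_comm, ← zpow_add₀ hy0.ne', ← zpow_add₀ hy0.ne']
  congr 2; ring

/-- The series form of Ramanujan's identity. -/
lemma ramanujan_series_identity {y : ℝ} (hy0 : 0 < y) (hy1 : y < 1) :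
    2 * ((∑' k : ℤ, (-1) ^ k * y ^ (10 * k ^ 2 + 2 * k)) *
          (∑' l : ℤ, (-1) ^ l * y ^ (15 * l ^ 2 + 3 * l)) +
        y ^ 2 * ((∑' k : ℤ, (-1) ^ k * y ^ (10 * k ^ 2 + 6 * k)) *
          ∑' l : ℤ, (-1) ^ l * y ^ (15 * l ^ 2 + 9 * l))) =
      (∑' m : ℤ, y ^ (m ^ 2 + m)) * ∑' n : ℤ, (-1) ^ n * y ^ (6 * n ^ 2) := by
  rw [← sum_thetaCoset hy0 hy1]
  have h4 := thetaCoset_reflect y 0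
  have h3 := thetaCoset_reflect y 1
  have h0 := thetaCoset_eq_mul hy0 hy1 0
  have h1 := thetaCoset_eq_mul hy0 hy1 1
  norm_num at h0 h1 h3 h4
  simp only [Fin.sum_univ_five]
  norm_num
  rw [thetaCoset_two, h3, h4, h0, h1]
  norm_cast
  ring

/-- The finite product `(p; p)_n`. -/
noncomputable def qFactorial (p : ℝ) (n : ℕ) : ℝ := ∏ i ∈ Finset.range n, (1 - p ^ (i + 1))

lemma qFactorial_succ (p : ℝ) (n : ℕ) :
    qFactorial p (n + 1) = qFactorial p n * (1 - p ^ (n + 1)) :=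
  Finset.prod_range_succ _ _

lemma one_sub_pow_succ_pos {p : ℝ} (hp0 : 0 < p) (hp1 : p < 1) (n : ℕ) : 0 < 1 - p ^ (n + 1) :=
  sub_pos.mpr (pow_lt_one₀ hp0.le hp1 n.succ_ne_zero)

lemma qFactorial_pos {p : ℝ} (hp0 : 0 < p) (hp1 : p < 1) (n : ℕ) : 0 < qFactorial p n :=
  Finset.prod_pos fun i _ ↦ one_sub_pow_succ_pos hp0 hp1 i

lemma qFactorial_le_one {p : ℝ} (hp0 : 0 < p) (hp1 : p < 1) (n : ℕ) : qFactorial p n ≤ 1 :=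
  Finset.prod_le_one (fun i _ ↦ (one_sub_pow_succ_pos hp0 hp1 i).le)
    fun _ _ ↦ sub_le_self _ (pow_pos hp0 _).le

/-- Products `∏ (1 + u p^(i + b))` converge for `0 < p < 1`. -/
lemma multipliable_one_add_mul_pow {p : ℝ} (hp0 : 0 < p) (hp1 : p < 1) (u : ℝ) (b : ℕ) :
    Multipliable fun i : ℕ ↦ 1 + u * p ^ (i + b) := by
  apply Real.multipliable_one_add_of_summable
  simp_rw [pow_add]
  exact ((summable_geometric_of_lt_one hp0.le hp1).mul_right _).mul_left _

lemma multipliable_one_sub_pow {p : ℝ} (hp0 : 0 < p) (hp1 : p < 1) :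
    Multipliable fun i : ℕ ↦ 1 - p ^ (i + 1) := by
  simpa [sub_eq_add_neg] using multipliable_one_add_mul_pow hp0 hp1 (-1) 1

lemma tendsto_qFactorial {p : ℝ} (hp0 : 0 < p) (hp1 : p < 1) :
    Tendsto (qFactorial p) atTop (𝓝 (eulerProd p)) :=
  (multipliable_one_sub_pow hp0 hp1).tendsto_prod_tprod_nat

lemma eulerProd_le_qFactorial {p : ℝ} (hp0 : 0 < p) (hp1 : p < 1) (n : ℕ) :
    eulerProd p ≤ qFactorial p n := by
  refine Antitone.le_of_tendsto (antitone_nat_of_succ_le fun n ↦ ?_) (tendsto_qFactorial hp0 hp1) n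
  rw [qFactorial_succ]
  exact mul_le_of_le_one_right (qFactorial_pos hp0 hp1 n).le (sub_le_self _ (pow_pos hp0 _).le)

lemma eulerProd_pos {p : ℝ} (hp0 : 0 < p) (hp1 : p < 1) : 0 < eulerProd p := by
  refine lt_of_le_of_ne (ge_of_tendsto' (tendsto_qFactorial hp0 hp1)
    fun n ↦ (qFactorial_pos hp0 hp1 n).le) (Ne.symm ?_)
  have h := tprod_one_add_ne_zero_of_summable (R := ℝ) (f := fun i : ℕ ↦ -p ^ (i + 1))
    (fun i ↦ by
      rw [← sub_eq_add_neg]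
      exact (one_sub_pow_succ_pos hp0 hp1 i).ne')
    (by simpa [abs_of_pos hp0] using
      (summable_nat_add_iff 1).mpr (summable_geometric_of_lt_one hp0.le hp1))
  simpa only [eulerProd, sub_eq_add_neg] using h

/-- The Gaussian binomial coefficient `[M choose j]` at the parameter `p`. -/
noncomputable def qBinom (p : ℝ) (M j : ℕ) : ℝ :=
  qFactorial p M / (qFactorial p j * qFactorial p (M - j))

lemma qBinom_zero_right {p : ℝ} (hp0 : 0 < p) (hp1 : p < 1) (M : ℕ) : qBinom p M 0 = 1 := by
  have := (qFactorial_pos hp0 hp1 M).ne'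
  have h0 : qFactorial p 0 = 1 := Finset.prod_range_zero _
  simp [qBinom, h0, this]

lemma qBinom_self {p : ℝ} (hp0 : 0 < p) (hp1 : p < 1) (M : ℕ) : qBinom p M M = 1 := by
  have := (qFactorial_pos hp0 hp1 M).ne'
  have h0 : qFactorial p 0 = 1 := Finset.prod_range_zero _
  simp [qBinom, h0, this]

lemma qBinom_succ_succ {p : ℝ} (hp0 : 0 < p) (hp1 : p < 1) {M j : ℕ} (hj : j < M) :
    qBinom p (M + 1) (j + 1) = qBinom p M (j + 1) + p ^ (M - j) * qBinom p M j := by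
  obtain ⟨d, rfl⟩ : ∃ d, M = j + d + 1 := ⟨M - j - 1, by omega⟩
  have h1 : j + d + 1 + 1 - (j + 1) = d + 1 := by omega
  have h2 : j + d + 1 - (j + 1) = d := by omega
  have h3 : j + d + 1 - j = d + 1 := by omega
  rw [qBinom, qBinom, qBinom, h1, h2, h3, qFactorial_succ p (j + d + 1), qFactorial_succ p j,
    qFactorial_succ p d]
  have := (qFactorial_pos hp0 hp1 j).ne'
  have := (qFactorial_pos hp0 hp1 d).ne'
  have := (one_sub_pow_succ_pos hp0 hp1 j).ne'
  have := (one_sub_pow_succ_pos hp0 hp1 d).ne'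
  field_simp
  ring

/-- The `q`-binomial theorem. -/
lemma prod_one_add_mul_pow {y : ℝ} (hy0 : 0 < y) (hy1 : y < 1) (w : ℝ) (M : ℕ) :
    ∏ k ∈ Finset.range M, (1 + w * (y ^ 2) ^ k) =
      ∑ j ∈ Finset.range (M + 1), qBinom (y ^ 2) M j * y ^ ((j : ℤ) ^ 2 - j) * w ^ j := by
  have hp0 : 0 < y ^ 2 := by positivity
  have hp1 : y ^ 2 < 1 := pow_lt_one₀ hy0.le hy1 two_ne_zero
  induction M with
  | zero => simp [qBinom_self hp0 hp1]
  | succ M ih =>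
    have hexp (j : ℕ) : y ^ (((j + 1 : ℕ) : ℤ) ^ 2 - (j + 1 : ℕ)) =
        y ^ ((j : ℤ) ^ 2 - j) * (y ^ 2) ^ j := by
      rw [← pow_mul, ← zpow_natCast, ← zpow_add₀ hy0.ne']
      congr 1; push_cast; ring
    rw [Finset.prod_range_succ, ih, mul_add, mul_one, Finset.sum_range_succ' _ (M + 1),
      Finset.sum_range_succ _ M]
    nth_rewrite 1 [← Finset.sum_range_succ]
    rw [Finset.sum_range_succ', Finset.sum_range_succ _ M, add_mul, Finset.sum_mul,
      qBinom_zero_right hp0 hp1, qBinom_zero_right hp0 hp1, qBinom_self hp0 hp1,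
      qBinom_self hp0 hp1]
    have hstep : ∀ j ∈ Finset.range M,
        qBinom (y ^ 2) (M + 1) (j + 1) * y ^ (((j + 1 : ℕ) : ℤ) ^ 2 - (j + 1 : ℕ)) * w ^ (j + 1) =
        qBinom (y ^ 2) M (j + 1) * y ^ (((j + 1 : ℕ) : ℤ) ^ 2 - (j + 1 : ℕ)) * w ^ (j + 1) +
        qBinom (y ^ 2) M j * y ^ ((j : ℤ) ^ 2 - j) * w ^ j * (w * (y ^ 2) ^ M) := by
      intro j hj
      have hjM := Finset.mem_range.mp hj
      have : (y ^ 2) ^ M = (y ^ 2) ^ (M - j) * (y ^ 2) ^ j := by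
        rw [← pow_add, Nat.sub_add_cancel hjM.le]
      rw [qBinom_succ_succ hp0 hp1 hjM, hexp, this]
      ring
    rw [Finset.sum_congr rfl hstep, Finset.sum_add_distrib, hexp]
    ring

/-- The finite form of the Jacobi triple product identity. -/
lemma finite_jacobi_triple_product {y : ℝ} (hy0 : 0 < y) (hy1 : y < 1) {u : ℝ} (hu : u ≠ 0)
    (N : ℕ) :
    (∏ i ∈ Finset.range N, (1 + u⁻¹ * (y ^ 2) ^ (i + 1))) *
        ∏ i ∈ Finset.range N, (1 + u * (y ^ 2) ^ i) =
      ∑ j ∈ Finset.range (2 * N + 1),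
        qBinom (y ^ 2) (2 * N) j * (y ^ (((j : ℤ) - N) ^ 2 - (j - N)) * u ^ ((j : ℤ) - N)) := by
  have hy := hy0.ne'
  have h := prod_one_add_mul_pow hy0 hy1 (u * y ^ (-2 * (N : ℤ))) (2 * N)
  have hfac (i : ℕ) : 1 + u * y ^ (-2 * ((i : ℤ) + 1)) =
      u * y ^ (-2 * ((i : ℤ) + 1)) * (1 + u⁻¹ * (y ^ 2) ^ (i + 1)) := by
    have : y ^ (-2 * ((i : ℤ) + 1)) * (y ^ 2) ^ (i + 1) = 1 := by
      rw [← pow_mul, ← zpow_natCast, ← zpow_add₀ hy]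
      simp
    field_simp
    linear_combination -this
  have hprod : ∏ i ∈ Finset.range N, (u * y ^ (-2 * ((i : ℤ) + 1))) =
      u ^ N * y ^ (-(N : ℤ) ^ 2 - N) := by
    clear h
    induction N with
    | zero => simp
    | succ N ih =>
      rw [Finset.prod_range_succ, ih, mul_mul_mul_comm, ← pow_succ, ← zpow_add₀ hy]
      congr 2; push_cast; ring
  rw [two_mul N, Finset.prod_range_add, ← Finset.prod_range_reflect _ N, ← two_mul] at h
  have hlow : ∏ i ∈ Finset.range N, (1 + u * y ^ (-2 * (N : ℤ)) * (y ^ 2) ^ (N - 1 - i)) =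
      u ^ N * y ^ (-(N : ℤ) ^ 2 - N) *
        ∏ i ∈ Finset.range N, (1 + u⁻¹ * (y ^ 2) ^ (i + 1)) := by
    rw [← hprod, ← Finset.prod_mul_distrib]
    refine Finset.prod_congr rfl fun i hi ↦ ?_
    have hiN := Finset.mem_range.mp hi
    rw [← hfac, mul_assoc, ← pow_mul, ← zpow_natCast y, ← zpow_add₀ hy]
    congr 3; push_cast [Nat.sub_sub, Nat.cast_sub (show 1 + i ≤ N by omega)]; ring
  have hhigh : ∏ i ∈ Finset.range N, (1 + u * y ^ (-2 * (N : ℤ)) * (y ^ 2) ^ (N + i)) =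
      ∏ i ∈ Finset.range N, (1 + u * (y ^ 2) ^ i) := by
    refine Finset.prod_congr rfl fun i _ ↦ ?_
    rw [mul_assoc, ← pow_mul, ← pow_mul, ← zpow_natCast y, ← zpow_natCast y, ← zpow_add₀ hy]
    congr 3; push_cast; ring
  rw [hlow, hhigh, mul_assoc] at h
  have hne : u ^ N * y ^ (-(N : ℤ) ^ 2 - N) ≠ 0 := by positivity
  apply mul_left_cancel₀ hne
  rw [h, Finset.mul_sum]
  refine Finset.sum_congr rfl fun j _ ↦ ?_
  rw [zpow_sub₀ hu, zpow_natCast, zpow_natCast, mul_pow, ← zpow_natCast (y ^ (-2 * (N : ℤ))),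
    ← zpow_mul]
  have : y ^ (-(N : ℤ) ^ 2 - N) * y ^ (((j : ℤ) - N) ^ 2 - (j - N)) =
      y ^ ((j : ℤ) ^ 2 - j) * y ^ (-2 * (N : ℤ) * j) := by
    rw [← zpow_add₀ hy, ← zpow_add₀ hy]
    congr 1; ring
  field_simp
  linear_combination (-qBinom (y ^ 2) (2 * N) j) * this

/-- The Jacobi triple product identity. -/
lemma jacobi_triple_product {y : ℝ} (hy0 : 0 < y) (hy1 : y < 1) {u : ℝ} (hu : u ≠ 0)
    (hs : Summable fun n : ℤ ↦ ‖y ^ (n ^ 2 - n) * u ^ n‖) :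
    eulerProd (y ^ 2) * ((∏' i : ℕ, (1 + u⁻¹ * (y ^ 2) ^ (i + 1))) *
        ∏' i : ℕ, (1 + u * (y ^ 2) ^ i)) =
      ∑' n : ℤ, y ^ (n ^ 2 - n) * u ^ n := by
  have hp0 : 0 < y ^ 2 := by positivity
  have hp1 : y ^ 2 < 1 := pow_lt_one₀ hy0.le hy1 two_ne_zero
  have hE := eulerProd_pos hp0 hp1
  have hlim := (multipliable_one_add_mul_pow hp0 hp1 u⁻¹ 1).tendsto_prod_tprod_nat.mul
    (multipliable_one_add_mul_pow hp0 hp1 u 0).tendsto_prod_tprod_nat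
  simp only [add_zero, finite_jacobi_triple_product hy0 hy1 hu] at hlim
  let c : ℕ → ℤ → ℝ := fun N n ↦
    if n ∈ Finset.Icc (-(N : ℤ)) N then qBinom (y ^ 2) (2 * N) (n + N).toNat else 0
  have hsum (N : ℕ) : ∑ j ∈ Finset.range (2 * N + 1),
      qBinom (y ^ 2) (2 * N) j * (y ^ (((j : ℤ) - N) ^ 2 - (j - N)) * u ^ ((j : ℤ) - N)) =
      ∑' n : ℤ, c N n * (y ^ (n ^ 2 - n) * u ^ n) := by
    rw [tsum_eq_sum (s := Finset.Icc (-(N : ℤ)) N)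
      fun n hn ↦ by simp only [c, if_neg hn, zero_mul]]
    refine Finset.sum_bij' (fun j _ ↦ (j : ℤ) - N) (fun n _ ↦ (n + N).toNat) ?_ ?_ ?_ ?_ ?_
    · intro j hj
      rw [Finset.mem_range] at hj
      rw [Finset.mem_Icc]
      omega
    · intro n hn
      rw [Finset.mem_Icc] at hn
      rw [Finset.mem_range]
      omega
    · intro j hj
      simp
    · intro n hn
      rw [Finset.mem_Icc] at hn
      omega
    · intro j hj
      rw [Finset.mem_range] at hj
      have : (j : ℤ) - N ∈ Finset.Icc (-(N : ℤ)) N := by rw [Finset.mem_Icc]; omega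
      simp only [c, if_pos this, sub_add_cancel, Int.toNat_natCast]
  simp only [hsum] at hlim
  have hlim' : Tendsto (fun N ↦ ∑' n : ℤ, c N n * (y ^ (n ^ 2 - n) * u ^ n)) atTop
      (𝓝 (∑' n : ℤ, (eulerProd (y ^ 2))⁻¹ * (y ^ (n ^ 2 - n) * u ^ n))) := by
    refine tendsto_tsum_of_dominated_convergence
      (bound := fun n ↦ (eulerProd (y ^ 2) * eulerProd (y ^ 2))⁻¹ * ‖y ^ (n ^ 2 - n) * u ^ n‖)
      (hs.mul_left _) (fun n ↦ ?_) (Eventually.of_forall fun N n ↦ ?_)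
    · refine Tendsto.mul_const _ ?_
      have h1 : Tendsto (fun N : ℕ ↦ qBinom (y ^ 2) (2 * N) (n + N).toNat) atTop
          (𝓝 (eulerProd (y ^ 2) / (eulerProd (y ^ 2) * eulerProd (y ^ 2)))) := by
        have hq := tendsto_qFactorial hp0 hp1
        refine (hq.comp ?_).div ((hq.comp ?_).mul (hq.comp ?_)) (mul_pos hE hE).ne'
        · exact tendsto_id.const_mul_atTop' two_pos
        · exact tendsto_atTop_mono (f := fun N ↦ N - n.natAbs) (fun N ↦ by omega)
            (tendsto_sub_atTop_nat _)
        · exact tendsto_atTop_mono (f := fun N ↦ N - n.natAbs) (fun N ↦ by omega)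
            (tendsto_sub_atTop_nat _)
      rw [div_mul_cancel_left₀ hE.ne'] at h1
      refine h1.congr' ?_
      filter_upwards [eventually_ge_atTop n.natAbs] with N hN
      have : n ∈ Finset.Icc (-(N : ℤ)) N := by rw [Finset.mem_Icc]; omega
      simp only [c, if_pos this]
    · rw [norm_mul]
      refine mul_le_mul_of_nonneg_right ?_ (norm_nonneg _)
      have hb := inv_pos.mpr (mul_pos hE hE)
      simp only [c]
      split_ifs
      · have hq := qFactorial_pos hp0 hp1
        have hle := eulerProd_le_qFactorial hp0 hp1
        rw [qBinom, Real.norm_of_nonneg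
          (div_nonneg (hq _).le (mul_pos (hq _) (hq _)).le), ← one_div]
        exact div_le_div₀ zero_le_one (qFactorial_le_one hp0 hp1 _) (mul_pos hE hE)
          (mul_le_mul (hle _) (hle _) hE.le (hq _).le)
      · simpa using hb.le
  rw [tendsto_nhds_unique hlim hlim', tsum_mul_left, mul_inv_cancel_left₀ hE.ne']

/-- The odd product `(x; x²)_∞`. -/
noncomputable def oddProd (x : ℝ) : ℝ := ∏' i : ℕ, (1 - x ^ (2 * i + 1))

lemma multipliable_one_sub_pow_mul_add {x : ℝ} (hx0 : 0 < x) (hx1 : x < 1) {a : ℕ} (ha : a ≠ 0)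
    (b : ℕ) : Multipliable fun i : ℕ ↦ 1 - x ^ (a * i + b) := by
  refine (multipliable_one_add_mul_pow (pow_pos hx0 a) (pow_lt_one₀ hx0.le hx1 ha)
    (-x ^ b) 0).congr fun i ↦ ?_
  rw [add_zero, pow_add, pow_mul]
  ring

lemma eulerProd_eq_oddProd_mul {x : ℝ} (hx0 : 0 < x) (hx1 : x < 1) :
    eulerProd x = oddProd x * eulerProd (x ^ 2) := by
  have h1 := multipliable_one_sub_pow_mul_add hx0 hx1 two_ne_zero 1
  have h2 := multipliable_one_sub_pow_mul_add hx0 hx1 two_ne_zero 2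
  rw [eulerProd, ← tprod_even_mul_odd (f := fun i ↦ 1 - x ^ (i + 1)) h1 h2, oddProd, eulerProd]
  congr 1
  refine tprod_congr fun i ↦ ?_
  rw [← pow_mul]
  ring

lemma oddProd_pos {x : ℝ} (hx0 : 0 < x) (hx1 : x < 1) : 0 < oddProd x := by
  have h := eulerProd_pos hx0 hx1
  rw [eulerProd_eq_oddProd_mul hx0 hx1] at h
  exact pos_of_mul_pos_left h
    (eulerProd_pos (pow_pos hx0 2) (pow_lt_one₀ hx0.le hx1 two_ne_zero)).le

lemma eulerProd_mul_tprod_one_add {x : ℝ} (hx0 : 0 < x) (hx1 : x < 1) :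
    eulerProd x * ∏' i : ℕ, (1 + x ^ (i + 1)) = eulerProd (x ^ 2) := by
  have h : Multipliable fun i : ℕ ↦ 1 + x ^ (i + 1) := by
    simpa using multipliable_one_add_mul_pow hx0 hx1 1 1
  rw [eulerProd, ← (multipliable_one_sub_pow hx0 hx1).tprod_mul h, eulerProd]
  refine tprod_congr fun i ↦ ?_
  rw [← pow_mul]
  ring

/-- Euler's identity `(-x; x)_∞ (x; x²)_∞ = 1`. -/
lemma oddProd_mul_tprod_one_add {x : ℝ} (hx0 : 0 < x) (hx1 : x < 1) :
    oddProd x * ∏' i : ℕ, (1 + x ^ (i + 1)) = 1 := by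
  have h := eulerProd_mul_tprod_one_add hx0 hx1
  have hE := eulerProd_pos (pow_pos hx0 2) (pow_lt_one₀ hx0.le hx1 two_ne_zero)
  rw [eulerProd_eq_oddProd_mul hx0 hx1] at h
  apply mul_right_cancel₀ hE.ne'
  linear_combination h

/-- Gauss's product for `∑ x^(m(m+1)/2)`, with `x = y²`. -/
lemma tsum_triangular {y : ℝ} (hy0 : 0 < y) (hy1 : y < 1) :
    ∑' m : ℤ, y ^ (m ^ 2 + m) = 2 * (eulerProd ((y ^ 2) ^ 2) / oddProd (y ^ 2)) := by
  have hx0 : 0 < y ^ 2 := by positivity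
  have hx1 : y ^ 2 < 1 := pow_lt_one₀ hy0.le hy1 two_ne_zero
  have hs : Summable fun n : ℤ ↦ ‖y ^ (n ^ 2 - n) * 1 ^ n‖ := by
    simpa [abs_of_pos hy0, sub_eq_add_neg] using summable_quadratic hy0 hy1 1 (-1) one_pos
  have h := jacobi_triple_product hy0 hy1 one_ne_zero hs
  simp only [inv_one, one_mul, one_zpow, mul_one] at h
  have hm : Multipliable fun i : ℕ ↦ 1 + (y ^ 2) ^ (i + 1) := by
    simpa using multipliable_one_add_mul_pow hx0 hx1 1 1
  have hzero : ∏' i : ℕ, (1 + (y ^ 2) ^ i) = 2 * ∏' i : ℕ, (1 + (y ^ 2) ^ (i + 1)) := by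
    rw [tprod_eq_zero_mul' (f := fun i ↦ 1 + (y ^ 2) ^ i) hm, pow_zero,
      one_add_one_eq_two]
  have hneg : ∑' m : ℤ, y ^ (m ^ 2 + m) = ∑' n : ℤ, y ^ (n ^ 2 - n) := by
    rw [← (Equiv.neg ℤ).tsum_eq]
    simp only [Equiv.neg_apply, neg_sq, ← sub_eq_add_neg]
  have hE := eulerProd_mul_tprod_one_add hx0 hx1
  have hO := oddProd_mul_tprod_one_add hx0 hx1
  rw [hneg, ← h, hzero, ← hE, div_eq_mul_inv, ← eq_inv_of_mul_eq_one_right hO]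
  ring

/-- Gauss's product for `∑ (-1)ⁿ t^(n²)`. -/
lemma tsum_alternating_square {t : ℝ} (ht0 : 0 < t) (ht1 : t < 1) :
    ∑' n : ℤ, (-1) ^ n * t ^ (n ^ 2) = eulerProd t * oddProd t := by
  have ht := ht0.ne'
  have hterm (n : ℤ) : t ^ (n ^ 2 - n) * (-t) ^ n = (-1) ^ n * t ^ (n ^ 2) := by
    rw [neg_eq_neg_one_mul, mul_zpow, mul_left_comm, ← zpow_add₀ ht, sub_add_cancel]
  have hs : Summable fun n : ℤ ↦ ‖t ^ (n ^ 2 - n) * (-t) ^ n‖ := by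
    simp only [hterm]
    simpa using summable_alternating_quadratic ht0 ht1 1 0 one_pos
  have h := jacobi_triple_product ht0 ht1 (neg_ne_zero.mpr ht) hs
  simp only [hterm] at h
  have h1 : ∏' i : ℕ, (1 + (-t)⁻¹ * (t ^ 2) ^ (i + 1)) = oddProd t := by
    refine tprod_congr fun i ↦ ?_
    rw [pow_succ (t ^ 2), pow_succ t (2 * i), pow_mul]
    field_simp
    ring
  have h2 : ∏' i : ℕ, (1 + -t * (t ^ 2) ^ i) = oddProd t := by
    refine tprod_congr fun i ↦ ?_
    rw [pow_succ t (2 * i), pow_mul]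
    ring
  rw [← h, h1, h2, eulerProd_eq_oddProd_mul ht0 ht1]
  ring

lemma oddProd_trisection {x : ℝ} (hx0 : 0 < x) (hx1 : x < 1) :
    oddProd x =
      oddProd (x ^ 3) * ∏' n : ℕ, ((1 - x ^ (6 * n + 1)) * (1 - x ^ (6 * n + 5))) := by
  have h1 := multipliable_one_sub_pow_mul_add hx0 hx1 (show 6 ≠ 0 by norm_num) 1
  have h5 := multipliable_one_sub_pow_mul_add hx0 hx1 (show 6 ≠ 0 by norm_num) 5
  have h3 := multipliable_one_sub_pow_mul_add (pow_pos hx0 3)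
    (pow_lt_one₀ hx0.le hx1 three_ne_zero) two_ne_zero 1
  have hblock (N : ℕ) : ∏ i ∈ Finset.range (3 * N), (1 - x ^ (2 * i + 1)) =
      (∏ i ∈ Finset.range N, (1 - (x ^ 3) ^ (2 * i + 1))) *
        ∏ i ∈ Finset.range N, ((1 - x ^ (6 * i + 1)) * (1 - x ^ (6 * i + 5))) := by
    induction N with
    | zero => simp
    | succ N ih =>
      rw [mul_add, mul_one, Finset.prod_range_succ, Finset.prod_range_succ, Finset.prod_range_succ,
        ih, Finset.prod_range_succ, Finset.prod_range_succ]
      ring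
  have hl := (multipliable_one_sub_pow_mul_add hx0 hx1 two_ne_zero 1).tendsto_prod_tprod_nat.comp
    (tendsto_id.const_mul_atTop' three_pos)
  have hr := h3.tendsto_prod_tprod_nat.mul (h1.mul h5).tendsto_prod_tprod_nat
  exact tendsto_nhds_unique hl (hr.congr fun N ↦ (hblock N).symm)

/-- Splitting an alternating theta series into its even and odd terms. -/
lemma tsum_alternating_quadratic_split {y : ℝ} (hy0 : 0 < y) (hy1 : y < 1) (a b : ℤ)
    (ha : 0 < a) :
    ∑' k : ℤ, (y ^ (4 * a * k ^ 2 + 2 * b * k) -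
        y ^ (4 * a * k ^ 2 + (4 * a - 2 * b) * k + (a - b))) =
      ∑' k : ℤ, (-1) ^ k * y ^ (a * k ^ 2 + b * k) := by
  let e : Fin 2 × ℤ ≃ ℤ := (Equiv.prodComm _ _).trans (Int.divModEquiv 2).symm
  have hs := (summable_alternating_quadratic hy0 hy1 a b ha).of_norm
  have hse := e.summable_iff.mpr hs
  have h0 (k : ℤ) : (-1 : ℝ) ^ e (0, k) * y ^ (a * e (0, k) ^ 2 + b * e (0, k)) =
      y ^ (4 * a * k ^ 2 + 2 * b * k) := by
    have : e (0, k) = 2 * k := by simp [e, Int.divModEquiv]; ring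
    rw [this, zpow_mul]
    norm_num
    congr 1; ring
  have h1 (k : ℤ) : (-1 : ℝ) ^ e (1, -k - 1) * y ^ (a * e (1, -k - 1) ^ 2 + b * e (1, -k - 1)) =
      -y ^ (4 * a * k ^ 2 + (4 * a - 2 * b) * k + (a - b)) := by
    have : e (1, -k - 1) = 1 - 2 * (k + 1) := by simp [e, Int.divModEquiv]; ring
    rw [this, neg_one_zpow_sub_two_mul]
    norm_num
    congr 1; ring
  let r : ℤ ≃ ℤ := (Equiv.neg ℤ).trans (Equiv.subRight 1)
  have hs0 := hse.prod_factor 0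
  have hs1 := r.summable_iff.mpr (hse.prod_factor 1)
  have he : ∑' p, ((fun n : ℤ ↦ (-1 : ℝ) ^ n * y ^ (a * n ^ 2 + b * n)) ∘ e) p =
      ∑' k : ℤ, (-1) ^ k * y ^ (a * k ^ 2 + b * k) :=
    e.tsum_eq fun n : ℤ ↦ (-1 : ℝ) ^ n * y ^ (a * n ^ 2 + b * n)
  rw [← he, (hse.tsum_prod.trans (tsum_fintype _)).trans (Fin.sum_univ_two _),
    ← r.tsum_eq fun k ↦ ((fun n : ℤ ↦ (-1 : ℝ) ^ n * y ^ (a * n ^ 2 + b * n)) ∘ e) (1, k)]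
  have hr (k : ℤ) : r k = -k - 1 := rfl
  simp only [Function.comp_def, hr, h0, h1] at hs0 hs1 ⊢
  rw [← hs0.tsum_add hs1]
  rfl

lemma minChar_one_two {y p : ℝ} (hy0 : 0 < y) (hy1 : y < 1) {a : ℕ} (ha : 0 < a)
    (hp : p = y ^ (2 * a)) :
    minChar 2 5 1 2 p = p ^ (-(1 : ℝ) / 60) * (eulerProd p)⁻¹ *
      ∑' k : ℤ, (-1) ^ k * y ^ (5 * a * k ^ 2 + a * k) := by
  rw [minChar, ← tsum_alternating_quadratic_split hy0 hy1 _ _ (by positivity)]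
  congr 2
  · norm_num
  · funext k
    rw [hp, ← zpow_natCast, ← zpow_mul, ← zpow_mul]
    congr 2 <;> push_cast <;> ring

lemma minChar_one_one {y p : ℝ} (hy0 : 0 < y) (hy1 : y < 1) {a : ℕ} (ha : 0 < a)
    (hp : p = y ^ (2 * a)) :
    minChar 2 5 1 1 p = p ^ ((11 : ℝ) / 60) * (eulerProd p)⁻¹ *
      ∑' k : ℤ, (-1) ^ k * y ^ (5 * a * k ^ 2 + 3 * a * k) := by
  rw [minChar, ← tsum_alternating_quadratic_split hy0 hy1 _ _ (by positivity)]
  congr 2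
  · norm_num
  · funext k
    rw [hp, ← zpow_natCast, ← zpow_mul, ← zpow_mul]
    congr 2 <;> push_cast <;> ring

theorem ramanujan_identity (q : ℝ) (hq0 : 0 < q) (hq1 : q < 1) :
    q ^ (-(1 : ℝ) / 72) *
        ∏' n : ℕ, ((1 - q ^ ((6 * (n : ℝ) + 1) / 6)) * (1 - q ^ ((6 * (n : ℝ) + 5) / 6)))⁻¹ =
      minChar 2 5 1 2 (q ^ ((1 : ℝ) / 3)) * minChar 2 5 1 2 (q ^ ((1 : ℝ) / 2)) +
      minChar 2 5 1 1 (q ^ ((1 : ℝ) / 3)) * minChar 2 5 1 1 (q ^ ((1 : ℝ) / 2)) := by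
  obtain ⟨y, hy0, hy1, rfl⟩ : ∃ y : ℝ, 0 < y ∧ y < 1 ∧ q = y ^ 12 :=
    ⟨q ^ ((1 : ℝ) / 12), by positivity, Real.rpow_lt_one hq0.le hq1 (by norm_num), by
      rw [← Real.rpow_natCast, ← Real.rpow_mul hq0.le]; norm_num⟩
  have hpow (s : ℝ) : (y ^ 12) ^ s = y ^ (12 * s) := by
    rw [← Real.rpow_natCast, ← Real.rpow_mul hy0.le]; norm_num
  have hthird : (y ^ 12) ^ ((1 : ℝ) / 3) = y ^ (2 * 2) := by
    rw [hpow, ← Real.rpow_natCast]; norm_num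
  have hhalf : (y ^ 12) ^ ((1 : ℝ) / 2) = y ^ (2 * 3) := by
    rw [hpow, ← Real.rpow_natCast]; norm_num
  have hx0 : 0 < y ^ 2 := by positivity
  have hx1 : y ^ 2 < 1 := pow_lt_one₀ hy0.le hy1 two_ne_zero
  have ht0 : 0 < y ^ 6 := by positivity
  have ht1 : y ^ 6 < 1 := pow_lt_one₀ hy0.le hy1 (by norm_num)
  have hO := (oddProd_pos hx0 hx1).ne'
  have hOt := (oddProd_pos ht0 ht1).ne'
  have hE4 := (eulerProd_pos (pow_pos hx0 2) (pow_lt_one₀ hx0.le hx1 two_ne_zero)).ne'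
  have hE6 := (eulerProd_pos ht0 ht1).ne'
  have htri := oddProd_trisection hx0 hx1
  rw [← pow_mul] at htri hE4
  norm_num only at htri hE4
  have hprod : ∏' n : ℕ, ((1 - (y ^ 12) ^ ((6 * (n : ℝ) + 1) / 6)) *
      (1 - (y ^ 12) ^ ((6 * (n : ℝ) + 5) / 6)))⁻¹ = oddProd (y ^ 6) / oddProd (y ^ 2) := by
    have hterm (n b : ℕ) : (y ^ 12) ^ ((6 * (n : ℝ) + b) / 6) = (y ^ 2) ^ (6 * n + b) := by
      rw [hpow, ← pow_mul, ← Real.rpow_natCast]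
      congr 1; push_cast; ring
    have hm := (multipliable_one_sub_pow_mul_add hx0 hx1 (show 6 ≠ 0 by norm_num) 1).mul
      (multipliable_one_sub_pow_mul_add hx0 hx1 (show 6 ≠ 0 by norm_num) 5)
    have hQ : ∏' n : ℕ, ((1 - (y ^ 2) ^ (6 * n + 1)) * (1 - (y ^ 2) ^ (6 * n + 5))) ≠ 0 :=
      right_ne_zero_of_mul (htri ▸ hO)
    have h1 (n : ℕ) := hterm n 1
    have h5 (n : ℕ) := hterm n 5
    push_cast at h1 h5
    simp only [h1, h5]
    rw [hm.tprod_inv₀ hQ, htri, div_mul_cancel_left₀ hOt]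
  have hseries := ramanujan_series_identity hy0 hy1
  have hsq : ∑' n : ℤ, (-1) ^ n * y ^ (6 * n ^ 2) = eulerProd (y ^ 6) * oddProd (y ^ 6) := by
    rw [← tsum_alternating_square ht0 ht1]
    refine tsum_congr fun n ↦ ?_
    rw [zpow_mul]; norm_cast
  rw [tsum_triangular hy0 hy1, hsq, ← pow_mul] at hseries
  norm_num only at hseries
  rw [hprod, hthird, hhalf, minChar_one_two hy0 hy1 two_pos rfl,
    minChar_one_two hy0 hy1 three_pos rfl, minChar_one_one hy0 hy1 two_pos rfl,
    minChar_one_one hy0 hy1 three_pos rfl, hpow]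
  have hpref (s : ℝ) : (y ^ (2 * 2)) ^ s * (y ^ (2 * 3)) ^ s = y ^ (10 * s) := by
    rw [← Real.mul_rpow (by positivity) (by positivity), ← pow_add, ← Real.rpow_natCast,
      ← Real.rpow_mul hy0.le]
    norm_num
  have hG := hpref (-1 / 60)
  have hH : (y ^ (2 * 2)) ^ ((11 : ℝ) / 60) * (y ^ (2 * 3)) ^ ((11 : ℝ) / 60) =
      y ^ (12 * (-(1 : ℝ) / 72)) * y ^ 2 := by
    rw [hpref, ← Real.rpow_natCast, ← Real.rpow_add hy0]; norm_num
  rw [show (10 : ℝ) * (-1 / 60) = 12 * (-1 / 72) by norm_num] at hG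
  push_cast
  norm_num only at hseries hG hH ⊢
  generalize ∑' k : ℤ, (-1 : ℝ) ^ k * y ^ (10 * k ^ 2 + 2 * k) = F₁ at hseries ⊢
  generalize ∑' k : ℤ, (-1 : ℝ) ^ k * y ^ (15 * k ^ 2 + 3 * k) = F₂ at hseries ⊢
  generalize ∑' k : ℤ, (-1 : ℝ) ^ k * y ^ (10 * k ^ 2 + 6 * k) = G₁ at hseries ⊢
  generalize ∑' k : ℤ, (-1 : ℝ) ^ k * y ^ (15 * k ^ 2 + 9 * k) = G₂ at hseries ⊢
  have hquot : oddProd (y ^ 6) / oddProd (y ^ 2) =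
      (eulerProd (y ^ 4))⁻¹ * (eulerProd (y ^ 6))⁻¹ * (F₁ * F₂ + y ^ 2 * (G₁ * G₂)) := by
    field_simp at hseries ⊢
    linear_combination -hseries
  rw [hquot]
  linear_combination (-(eulerProd (y ^ 4))⁻¹ * (eulerProd (y ^ 6))⁻¹) *
    (F₁ * F₂ * hG + G₁ * G₂ * hH)
end

section
/- For every real number q with 0 < q < 1, the Frenkel–Kac–Wakimoto character of the simple affine W-algebra L(4/5) equals the sum of two minimal model characters: q^{−1/12} · (q)_∞^{−2} · Σ_{m,n∈ℤ} Σ_{(a,b,ε)} ε · q^{Q(5a + 20n − 4, 5b + 20m − 4)/40} = χ_{5,6}^{1,1}(q) + χ_{5,6}^{1,5}(q), where Q(x,y) = 2x² − 2xy + 2y², and the inner sum runs over the six triples (a,b,ε) ∈ {(1,1,+1), (0,1,−1), (1,0,−1), (−1,0,+1), (0,−1,+1), (−1,−1,−1)}. -/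
open scoped BigOperators

/-- The normalized quadratic form on the root lattice of `A₂`:
`|x α₁ + y α₂|² = 2x² - 2xy + 2y²`. -/
def rootQ (x y : ℤ) : ℤ := 2 * x ^ 2 - 2 * x * y + 2 * y ^ 2

open Filter Topology Finset

/-- The `q`-Pochhammer symbol `(a; x)_∞ = ∏_{i ≥ 0} (1 - a x^i)`. -/
noncomputable def qPoch (a x : ℝ) : ℝ := ∏' i : ℕ, (1 - a * x ^ i)

/-- The theta series `Σ_{n ∈ ℤ} x^(n²) w^n`. -/
noncomputable def theta (x w : ℝ) : ℝ := ∑' n : ℤ, x ^ (n ^ 2) * w ^ n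

/-! ### Infinite products -/

lemma abs_pow_lt_one {x : ℝ} (hx : |x| < 1) {n : ℕ} (hn : n ≠ 0) : |x ^ n| < 1 := by
  rw [abs_pow]; exact pow_lt_one₀ (abs_nonneg x) hx hn

lemma summable_norm_neg_mul_pow (a : ℝ) {x : ℝ} (hx : |x| < 1) :
    Summable fun i : ℕ => ‖-(a * x ^ i)‖ := by
  simp only [norm_neg, norm_mul, norm_pow]
  exact (summable_geometric_of_lt_one (norm_nonneg x) hx).mul_left _

lemma multipliable_one_sub_mul_pow (a : ℝ) {x : ℝ} (hx : |x| < 1) :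
    Multipliable fun i : ℕ => 1 - a * x ^ i := by
  simpa [sub_eq_add_neg] using multipliable_one_add_of_summable (summable_norm_neg_mul_pow a hx)

lemma tendsto_qPoch (a : ℝ) {x : ℝ} (hx : |x| < 1) :
    Tendsto (fun N : ℕ => ∏ i ∈ range N, (1 - a * x ^ i)) atTop (𝓝 (qPoch a x)) :=
  (multipliable_one_sub_mul_pow a hx).tendsto_prod_tprod_nat

lemma qPoch_ne_zero {a x : ℝ} (ha : |a| < 1) (hx : |x| < 1) : qPoch a x ≠ 0 := by
  have h := tprod_one_add_ne_zero_of_summable (f := fun i : ℕ => -(a * x ^ i)) ?_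
    (summable_norm_neg_mul_pow a hx)
  · simpa [qPoch, sub_eq_add_neg] using h
  · intro i hi
    have h1 : a * x ^ i = 1 := by linarith
    have h2 : |a| * |x| ^ i = 1 := by rw [← abs_pow, ← abs_mul, h1, abs_one]
    have h3 : |x| ^ i ≤ 1 := pow_le_one₀ (abs_nonneg x) hx.le
    nlinarith [abs_nonneg a]

lemma prod_range_mul_eq (f : ℕ → ℝ) (m N : ℕ) :
    ∏ i ∈ range (m * N), f i = ∏ j ∈ range m, ∏ i ∈ range N, f (m * i + j) := by
  induction N with
  | zero => simp
  | succ N ih => simp only [mul_add, mul_one, prod_range_add, ih, prod_range_succ, prod_mul_distrib]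

lemma qPoch_split (a : ℝ) {x : ℝ} (hx : |x| < 1) {m : ℕ} (hm : m ≠ 0) :
    qPoch a x = ∏ j ∈ range m, qPoch (a * x ^ j) (x ^ m) := by
  have hxm : |x ^ m| < 1 := by
    rw [abs_pow]; exact pow_lt_one₀ (abs_nonneg x) hx hm
  have h1 : Tendsto (fun N : ℕ => ∏ i ∈ range (m * N), (1 - a * x ^ i)) atTop (𝓝 (qPoch a x)) :=
    (tendsto_qPoch a hx).comp (tendsto_id.const_mul_atTop' (Nat.pos_of_ne_zero hm))
  have h2 := tendsto_finsetProd (range m) fun j _ => tendsto_qPoch (a * x ^ j) hxm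
  refine tendsto_nhds_unique h1 (h2.congr fun N => ?_)
  rw [prod_range_mul_eq]
  refine prod_congr rfl fun j _ => prod_congr rfl fun i _ => ?_
  rw [pow_add, pow_mul]; ring

lemma qPoch_mul_qPoch_neg (a : ℝ) {x : ℝ} (hx : |x| < 1) :
    qPoch a x * qPoch (-a) x = qPoch (a ^ 2) (x ^ 2) := by
  have hx2 : |x ^ 2| < 1 := by
    rw [abs_pow]; exact pow_lt_one₀ (abs_nonneg x) hx two_ne_zero
  refine tendsto_nhds_unique ((tendsto_qPoch a hx).mul (tendsto_qPoch (-a) hx))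
    ((tendsto_qPoch (a ^ 2) hx2).congr fun N => ?_)
  rw [← prod_mul_distrib]
  refine prod_congr rfl fun i _ => ?_
  rw [← pow_mul, mul_comm 2 i, pow_mul]; ring

/-! ### The Jacobi triple product -/

lemma summable_pow_sq_mul_pow {x w : ℝ} (hx0 : x ≠ 0) (hx : |x| < 1) (hw : w ≠ 0) :
    Summable fun n : ℕ => x ^ (n ^ 2) * w ^ n := by
  refine summable_of_ratio_test_tendsto_lt_one (l := 0) zero_lt_one
    (Eventually.of_forall fun n => by positivity) ?_
  have h : Tendsto (fun n : ℕ => |x| * |w| * (|x| ^ 2) ^ n) atTop (𝓝 (|x| * |w| * 0)) :=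
    (tendsto_pow_atTop_nhds_zero_of_lt_one (by positivity)
      (pow_lt_one₀ (abs_nonneg x) hx two_ne_zero)).const_mul _
  rw [mul_zero] at h
  refine h.congr fun n => ?_
  have hx' : |x| ≠ 0 := abs_ne_zero.2 hx0
  have hw' : |w| ≠ 0 := abs_ne_zero.2 hw
  simp only [norm_mul, norm_pow, Real.norm_eq_abs]
  field_simp
  ring

lemma summable_theta {x w : ℝ} (hx0 : x ≠ 0) (hx : |x| < 1) (hw : w ≠ 0) :
    Summable fun n : ℤ => x ^ (n ^ 2) * w ^ n := by
  refine Summable.of_nat_of_neg ?_ ?_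
  · refine (summable_pow_sq_mul_pow hx0 hx hw).congr fun n => ?_
    norm_cast
  · refine (summable_pow_sq_mul_pow hx0 hx (inv_ne_zero hw)).congr fun n => ?_
    rw [neg_sq, zpow_neg, inv_pow]
    norm_cast

/-- The `q`-binomial theorem, with the factor `(x; x)_M` divided out. -/
lemma prod_one_add_mul_pow_s8 {x : ℝ} (hx : ∀ k, ∏ i ∈ range k, (1 - x * x ^ i) ≠ 0) (w : ℝ) (M : ℕ) :
    ∏ i ∈ range M, (1 + w * x ^ i) = (∏ i ∈ range M, (1 - x * x ^ i)) *
      ∑ p ∈ antidiagonal M, x ^ (p.1.choose 2) * w ^ p.1 /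
        ((∏ i ∈ range p.1, (1 - x * x ^ i)) * ∏ i ∈ range p.2, (1 - x * x ^ i)) := by
  set Q : ℕ → ℝ := fun k => ∏ i ∈ range k, (1 - x * x ^ i) with hQ
  have hQs : ∀ k, Q (k + 1) = Q k * (1 - x * x ^ k) := fun k => prod_range_succ _ _
  induction M with
  | zero => simp
  | succ M ih =>
    rw [prod_range_succ, ih]
    change _ = Q (M + 1) * _
    rw [hQs, mul_assoc, mul_assoc]
    congr 1
    have key : (1 - x * x ^ M) * ∑ p ∈ antidiagonal (M + 1),
        x ^ (p.1.choose 2) * w ^ p.1 / (Q p.1 * Q p.2) =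
        ∑ p ∈ antidiagonal (M + 1),
          x ^ (p.1.choose 2) * w ^ p.1 / (Q p.1 * Q p.2) * (1 - x ^ p.2) +
        ∑ p ∈ antidiagonal (M + 1),
          x ^ (p.1.choose 2) * w ^ p.1 / (Q p.1 * Q p.2) * (x ^ p.2 * (1 - x ^ p.1)) := by
      rw [← sum_add_distrib, mul_sum]
      refine sum_congr rfl fun p hp => ?_
      have : x * x ^ M = x ^ p.1 * x ^ p.2 := by
        rw [← pow_add, (HasAntidiagonal.mem_antidiagonal.1 hp), pow_succ']
      rw [this]; ring
    change _ = (1 - x * x ^ M) * ∑ p ∈ antidiagonal (M + 1),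
        x ^ (p.1.choose 2) * w ^ p.1 / (Q p.1 * Q p.2)
    rw [key, Nat.sum_antidiagonal_succ', Nat.sum_antidiagonal_succ]
    simp only [pow_zero, sub_self, mul_zero, zero_add]
    rw [mul_add, mul_one, sum_mul]
    congr 1
    · refine sum_congr rfl fun p _ => ?_
      change x ^ (p.1.choose 2) * w ^ p.1 / (Q p.1 * Q p.2) = _
      have h1 : Q (p.2 + 1) ≠ 0 := hx _
      have h2 : Q p.1 ≠ 0 := hx _
      have h3 : Q p.2 ≠ 0 := hx _
      rw [hQs] at h1 ⊢
      have h4 := right_ne_zero_of_mul h1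
      rw [pow_succ' x p.2]
      field_simp
    · refine sum_congr rfl fun p hp => ?_
      change x ^ (p.1.choose 2) * w ^ p.1 / (Q p.1 * Q p.2) * (w * x ^ M) = _
      have h1 : Q (p.1 + 1) ≠ 0 := hx _
      have h2 : Q p.1 ≠ 0 := hx _
      have h3 : Q p.2 ≠ 0 := hx _
      rw [hQs] at h1 ⊢
      have h4 : 1 - x ^ p.1 * x ≠ 0 := by
        rw [mul_comm (x ^ p.1)]; exact right_ne_zero_of_mul h1
      rw [pow_succ' x p.1, Nat.choose_succ_succ', Nat.choose_one_right, pow_add, pow_succ w,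
        ← (HasAntidiagonal.mem_antidiagonal.1 hp), pow_add]
      field_simp

lemma finite_triple_product {t w : ℝ} (ht0 : t ≠ 0) (ht : |t| < 1) (hw : w ≠ 0) (N : ℕ) :
    ∏ i ∈ range N, ((1 + w * t * (t ^ 2) ^ i) * (1 + w⁻¹ * t * (t ^ 2) ^ i)) =
      (∏ i ∈ range (2 * N), (1 - t ^ 2 * (t ^ 2) ^ i)) *
      ∑ p ∈ antidiagonal (2 * N), t ^ (((p.1 : ℤ) - N) ^ 2) * w ^ ((p.1 : ℤ) - N) /
        ((∏ i ∈ range p.1, (1 - t ^ 2 * (t ^ 2) ^ i)) *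
          ∏ i ∈ range p.2, (1 - t ^ 2 * (t ^ 2) ^ i)) := by
  have hne : ∀ k, ∏ i ∈ range k, (1 - t ^ 2 * (t ^ 2) ^ i) ≠ 0 := by
    intro k
    refine prod_ne_zero_iff.2 fun i _ => ?_
    have h : |t ^ 2 * (t ^ 2) ^ i| < 1 := by
      rw [← pow_succ', ← pow_mul, abs_pow]
      exact pow_lt_one₀ (abs_nonneg t) ht (by positivity)
    have := (abs_lt.1 h).2
    linarith
  have hb := prod_one_add_mul_pow_s8 hne (w * t ^ (1 - 2 * (N : ℤ))) (2 * N)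
  have hl : ∏ i ∈ range (2 * N), (1 + w * t ^ (1 - 2 * (N : ℤ)) * (t ^ 2) ^ i) =
      (w ^ N * t ^ (-(N : ℤ) ^ 2)) *
      ∏ i ∈ range N, ((1 + w * t * (t ^ 2) ^ i) * (1 + w⁻¹ * t * (t ^ 2) ^ i)) := by
    rw [two_mul, prod_range_add, prod_mul_distrib, mul_comm (∏ i ∈ range N, (1 + w * t * (t ^ 2) ^ i)),
      ← mul_assoc]
    congr 1
    · rw [← prod_range_reflect]
      have : ∀ n : ℕ, w ^ n * t ^ (-(n : ℤ) ^ 2) = ∏ i ∈ range n, (w * t ^ (-(2 * (i : ℤ) + 1))) := by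
        intro n
        induction n with
        | zero => simp
        | succ n ih =>
          rw [prod_range_succ, ← ih, pow_succ]
          have : t ^ (-((n + 1 : ℕ) : ℤ) ^ 2) = t ^ (-(n : ℤ) ^ 2) * t ^ (-(2 * (n : ℤ) + 1)) := by
            rw [← zpow_add₀ ht0]; congr 1; push_cast; ring
          rw [this]; ring
      rw [this, ← prod_mul_distrib]
      refine prod_congr rfl fun i hi => ?_
      have hi' : i < N := mem_range.1 hi
      have e1 : t ^ (1 - 2 * (N : ℤ)) * (t ^ 2) ^ (N - 1 - i) = t ^ (-(2 * (i : ℤ) + 1)) := by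
        rw [← pow_mul, ← zpow_natCast, ← zpow_add₀ ht0]
        congr 1
        have : ((N - 1 - i : ℕ) : ℤ) = N - 1 - i := by omega
        push_cast [this]; ring
      have e2 : t * (t ^ 2) ^ i = (t ^ (-(2 * (i : ℤ) + 1)))⁻¹ := by
        rw [← zpow_neg, neg_neg, ← pow_mul, ← pow_succ', ← zpow_natCast]
        congr 1
      rw [mul_assoc w (t ^ _), e1, mul_assoc w⁻¹ t, e2]
      have : t ^ (-(2 * (i : ℤ) + 1)) ≠ 0 := zpow_ne_zero _ ht0
      field_simp
      ring
    · refine prod_congr rfl fun i _ => ?_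
      have e1 : t ^ (1 - 2 * (N : ℤ)) * (t ^ 2) ^ (N + i) = t * (t ^ 2) ^ i := by
        rw [← pow_mul, ← pow_mul, ← zpow_natCast, ← zpow_add₀ ht0, ← pow_succ', ← zpow_natCast]
        congr 1; push_cast; ring
      rw [mul_assoc, e1, mul_assoc]
  have hc : w ^ N * t ^ (-(N : ℤ) ^ 2) ≠ 0 := mul_ne_zero (pow_ne_zero _ hw) (zpow_ne_zero _ ht0)
  apply mul_left_cancel₀ hc
  rw [← hl, hb, mul_left_comm]
  congr 1
  rw [mul_sum]
  refine sum_congr rfl fun p _ => ?_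
  rw [← mul_div_assoc]
  congr 1
  have e1 : (t ^ 2) ^ (p.1.choose 2) = t ^ ((p.1 : ℤ) ^ 2 - p.1) := by
    rw [← pow_mul, ← zpow_natCast, mul_comm, Nat.choose_two_right,
      Nat.div_mul_cancel (Nat.even_mul_pred_self _).two_dvd]
    congr 1
    rcases p.1 with _ | k
    · simp
    · push_cast [Nat.add_sub_cancel]; ring
  rw [e1, mul_pow, ← zpow_natCast (t ^ _), ← zpow_mul, ← zpow_natCast w p.1, ← zpow_natCast w N]
  have e2 : w ^ (p.1 : ℤ) = w ^ (N : ℤ) * w ^ ((p.1 : ℤ) - N) := by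
    rw [← zpow_add₀ hw]; congr 1; ring
  have e3 : t ^ ((p.1 : ℤ) ^ 2 - p.1) * t ^ ((1 - 2 * (N : ℤ)) * p.1) =
      t ^ (-(N : ℤ) ^ 2) * t ^ (((p.1 : ℤ) - N) ^ 2) := by
    rw [← zpow_add₀ ht0, ← zpow_add₀ ht0]; congr 1; ring
  rw [e2]
  linear_combination (w ^ (N : ℤ) * w ^ ((p.1 : ℤ) - N)) * e3

/-- The Jacobi triple product identity. -/
theorem theta_eq_qPoch {t w : ℝ} (ht0 : t ≠ 0) (ht : |t| < 1) (hw : w ≠ 0) :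
    theta t w = qPoch (t ^ 2) (t ^ 2) * (qPoch (-(w * t)) (t ^ 2) * qPoch (-(w⁻¹ * t)) (t ^ 2)) := by
  have hx := abs_pow_lt_one ht two_ne_zero
  have hx0 : 0 < t ^ 2 := by positivity
  set Q : ℕ → ℝ := fun k => ∏ i ∈ range k, (1 - t ^ 2 * (t ^ 2) ^ i) with hQ
  have hlim : Tendsto Q atTop (𝓝 (qPoch (t ^ 2) (t ^ 2))) := tendsto_qPoch _ hx
  have hfac : ∀ i : ℕ, 0 < 1 - t ^ 2 * (t ^ 2) ^ i ∧ 1 - t ^ 2 * (t ^ 2) ^ i ≤ 1 := by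
    intro i
    have h1 : t ^ 2 * (t ^ 2) ^ i < 1 := by
      rw [← pow_succ']
      exact pow_lt_one₀ hx0.le (lt_of_le_of_lt (le_abs_self _) hx) (by positivity)
    have h2 : 0 < t ^ 2 * (t ^ 2) ^ i := by positivity
    constructor <;> linarith
  have hpos : ∀ k, 0 < Q k := fun k => prod_pos fun i _ => (hfac i).1
  have hanti : Antitone Q := antitone_nat_of_succ_le fun k => by
    rw [hQ]; simp only [prod_range_succ]
    exact mul_le_of_le_one_right (hpos k).le (hfac k).2
  have hge : ∀ k, qPoch (t ^ 2) (t ^ 2) ≤ Q k := fun k => hanti.le_of_tendsto hlim k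
  have hE : 0 < qPoch (t ^ 2) (t ^ 2) :=
    lt_of_le_of_ne (ge_of_tendsto' hlim fun k => (hpos k).le) (qPoch_ne_zero hx hx).symm
  set E := qPoch (t ^ 2) (t ^ 2) with hEdef
  let f : ℕ → ℤ → ℝ := fun N n => if n.natAbs ≤ N then
    t ^ (n ^ 2) * w ^ n / (Q (n + N).toNat * Q (N - n).toNat) else 0
  have hfin : ∀ N : ℕ, ∏ i ∈ range N, ((1 + w * t * (t ^ 2) ^ i) * (1 + w⁻¹ * t * (t ^ 2) ^ i)) =
      Q (2 * N) * ∑' n, f N n := by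
    intro N
    rw [finite_triple_product ht0 ht hw, tsum_eq_sum (s := Icc (-(N : ℤ)) N)]
    · congr 1
      refine sum_bij' (fun p _ => (p.1 : ℤ) - N) (fun n _ => ((n + N).toNat, (N - n).toNat))
        ?_ ?_ ?_ ?_ ?_
      · intro p hp
        have := (HasAntidiagonal.mem_antidiagonal.1 hp)
        rw [mem_Icc]; omega
      · intro n hn
        rw [mem_Icc] at hn
        rw [HasAntidiagonal.mem_antidiagonal]
        simp only
        omega
      · intro p hp
        have := (HasAntidiagonal.mem_antidiagonal.1 hp)
        ext <;> simp only <;> omega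
      · intro n hn
        rw [mem_Icc] at hn
        simp only; omega
      · intro p hp
        have := (HasAntidiagonal.mem_antidiagonal.1 hp)
        have h1 : ((p.1 : ℤ) - N).natAbs ≤ N := by omega
        have h2 : ((p.1 : ℤ) - N + N).toNat = p.1 := by omega
        have h3 : ((N : ℤ) - (p.1 - N)).toNat = p.2 := by omega
        simp only [f, if_pos h1, h2, h3, hQ]
    · intro n hn
      rw [mem_Icc] at hn
      exact if_neg (by omega)
  have hdom : Tendsto (fun N => ∑' n, f N n) atTop
      (𝓝 (∑' n : ℤ, t ^ (n ^ 2) * w ^ n / (E * E))) := by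
    refine tendsto_tsum_of_dominated_convergence
      (bound := fun n : ℤ => ‖t ^ (n ^ 2) * w ^ n‖ / (E * E))
      ((summable_theta ht0 ht hw).norm.div_const _) ?_ ?_
    · intro n
      have h1 : Tendsto (fun N : ℕ => (n + N).toNat) atTop atTop :=
        tendsto_atTop_mono (fun N => by omega) (tendsto_sub_atTop_nat n.natAbs)
      have h2 : Tendsto (fun N : ℕ => ((N : ℤ) - n).toNat) atTop atTop :=
        tendsto_atTop_mono (fun N => by omega) (tendsto_sub_atTop_nat n.natAbs)
      have h3 := ((hlim.comp h1).mul (hlim.comp h2))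
      refine (tendsto_const_nhds.div h3 (by positivity)).congr' ?_
      filter_upwards [eventually_ge_atTop n.natAbs] with N hN
      simp only [f, if_pos hN, Function.comp, Pi.div_apply]
    · refine Eventually.of_forall fun N n => ?_
      by_cases h : n.natAbs ≤ N
      · simp only [f, if_pos h, norm_div]
        refine div_le_div_of_nonneg_left (norm_nonneg _) (by positivity) ?_
        rw [norm_mul, Real.norm_of_nonneg (hpos _).le, Real.norm_of_nonneg (hpos _).le]
        exact mul_le_mul (hge _) (hge _) hE.le (hpos _).le
      · simp only [f, if_neg h, norm_zero]; positivity
  have hL : Tendsto (fun N : ℕ =>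
      ∏ i ∈ range N, ((1 + w * t * (t ^ 2) ^ i) * (1 + w⁻¹ * t * (t ^ 2) ^ i))) atTop
      (𝓝 (qPoch (-(w * t)) (t ^ 2) * qPoch (-(w⁻¹ * t)) (t ^ 2))) := by
    refine ((tendsto_qPoch (-(w * t)) hx).mul (tendsto_qPoch (-(w⁻¹ * t)) hx)).congr fun N => ?_
    rw [← prod_mul_distrib]
    refine prod_congr rfl fun i _ => by ring
  have hR := (hlim.comp (tendsto_id.const_mul_atTop' (two_pos : 0 < 2))).mul hdom
  have := tendsto_nhds_unique hL (hR.congr fun N => (hfin N).symm)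
  rw [this, tsum_div_const, theta]
  field_simp

/-! ### Theta identities of eta-quotient type -/

lemma qPoch_even_odd (a : ℝ) {x : ℝ} (hx : |x| < 1) :
    qPoch a x = qPoch a (x ^ 2) * qPoch (a * x) (x ^ 2) := by
  simpa [prod_range_succ] using qPoch_split a hx two_ne_zero

lemma qPoch_mod_three (a : ℝ) {x : ℝ} (hx : |x| < 1) :
    qPoch a x = qPoch a (x ^ 3) * qPoch (a * x) (x ^ 3) * qPoch (a * x ^ 2) (x ^ 3) := by
  simpa [prod_range_succ] using qPoch_split a hx three_ne_zero

/-- In terms of the Dedekind eta function,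
`η(τ) · η(3τ)²/η(6τ) = (η(2τ)η(3τ)²/(η(τ)η(6τ))) · η(τ)²/η(2τ)`. -/
lemma qPoch_mul_theta_neg_one {y : ℝ} (hy0 : y ≠ 0) (hy : |y| < 1) :
    qPoch (y ^ 2) (y ^ 2) * theta (y ^ 6) (-1) = theta (y ^ 3) y * theta (y ^ 2) (-1) := by
  have h2 : |y ^ 2| < 1 := abs_pow_lt_one hy (by norm_num)
  have h3 : |y ^ 3| < 1 := abs_pow_lt_one hy (by norm_num)
  have h6 : |y ^ 6| < 1 := abs_pow_lt_one hy (by norm_num)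
  rw [theta_eq_qPoch (pow_ne_zero _ hy0) h6 (by norm_num),
    theta_eq_qPoch (pow_ne_zero _ hy0) h3 hy0,
    theta_eq_qPoch (pow_ne_zero _ hy0) h2 (by norm_num)]
  have a1 := qPoch_even_odd (y ^ 2) h2
  have a2 := qPoch_mod_three (-(y ^ 2)) h2
  have a3 := qPoch_mul_qPoch_neg (y ^ 2) h2
  have a4 := qPoch_even_odd (y ^ 6) h6
  have a5 := qPoch_mul_qPoch_neg (y ^ 6) h6
  have n1 : qPoch (y ^ 4) (y ^ 4) ≠ 0 :=
    qPoch_ne_zero (abs_pow_lt_one hy (by norm_num)) (abs_pow_lt_one hy (by norm_num))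
  have n2 : qPoch (y ^ 12) (y ^ 12) ≠ 0 :=
    qPoch_ne_zero (abs_pow_lt_one hy (by norm_num)) (abs_pow_lt_one hy (by norm_num))
  have n3 : qPoch (-(y ^ 6)) (y ^ 6) ≠ 0 := qPoch_ne_zero (by rwa [abs_neg]) h6
  have i1 : y⁻¹ * y ^ 3 = y ^ 2 := by field_simp
  rw [i1]
  norm_num only at *
  ring_nf at *
  generalize qPoch (y ^ 2) (y ^ 2) = e1 at *
  generalize qPoch (y ^ 4) (y ^ 4) = e2 at *
  generalize qPoch (y ^ 6) (y ^ 6) = e3 at *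
  generalize qPoch (y ^ 12) (y ^ 12) = e6 at *
  generalize qPoch (y ^ 2) (y ^ 4) = o at *
  generalize qPoch (y ^ 6) (y ^ 12) = u at *
  generalize qPoch (-y ^ 2) (y ^ 2) = m at *
  generalize qPoch (-y ^ 2) (y ^ 6) = A at *
  generalize qPoch (-y ^ 4) (y ^ 6) = B at *
  generalize qPoch (-y ^ 6) (y ^ 6) = C at *
  have k1 : o * m = 1 := mul_left_cancel₀ n1 (by linear_combination a3 - m * a1)
  have k2 : u * C = 1 := mul_left_cancel₀ n2 (by linear_combination a5 - C * a4)
  have k3 : u = A * B * o := mul_right_cancel₀ n3 (by linear_combination k2 - k1 + o * a2)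
  linear_combination (e6 * u ^ 2) * a1 - B * A * e2 * o ^ 2 * a4 + e2 * o * e6 * u * k3

lemma theta_mul_theta_eq_qPoch_mul_theta {y : ℝ} (hy0 : y ≠ 0) (hy : |y| < 1) :
    theta (y ^ 3) (y ^ 2) * theta (y ^ 2) (-y) = qPoch (y ^ 2) (y ^ 2) * theta (y ^ 6) (-y ^ 3) := by
  have h2 : |y ^ 2| < 1 := abs_pow_lt_one hy (by norm_num)
  have h3 : |y ^ 3| < 1 := abs_pow_lt_one hy (by norm_num)
  have h6 : |y ^ 6| < 1 := abs_pow_lt_one hy (by norm_num)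
  rw [theta_eq_qPoch (pow_ne_zero _ hy0) h3 (pow_ne_zero _ hy0),
    theta_eq_qPoch (pow_ne_zero _ hy0) h2 (neg_ne_zero.2 hy0),
    theta_eq_qPoch (pow_ne_zero _ hy0) h6 (neg_ne_zero.2 (pow_ne_zero _ hy0))]
  have a1 := qPoch_even_odd y h2
  have a2 := qPoch_mod_three (-y) h2
  have a3 := qPoch_mul_qPoch_neg y h2
  have a4 := qPoch_even_odd (y ^ 2) h2
  have a5 := qPoch_even_odd (y ^ 3) h6
  have a6 := qPoch_mul_qPoch_neg (y ^ 3) h6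
  have a7 := qPoch_even_odd (y ^ 6) h6
  have i1 : (y ^ 2)⁻¹ * y ^ 3 = y := by field_simp
  have i2 : (-y)⁻¹ * y ^ 2 = -y := by field_simp
  have i3 : (-y ^ 3)⁻¹ * y ^ 6 = -y ^ 3 := by field_simp
  rw [i1, i2, i3]
  ring_nf at *
  generalize qPoch (y ^ 2) (y ^ 2) = e2 at *
  generalize qPoch (y ^ 4) (y ^ 4) = e4 at *
  generalize qPoch (y ^ 6) (y ^ 6) = e6 at *
  generalize qPoch (y ^ 12) (y ^ 12) = e12 at *
  generalize qPoch (y ^ 2) (y ^ 4) = v at *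
  generalize qPoch (y ^ 6) (y ^ 12) = w at *
  generalize qPoch y (y ^ 2) = O at *
  generalize qPoch y (y ^ 4) = O1 at *
  generalize qPoch (y ^ 3) (y ^ 4) = O3 at *
  generalize qPoch (-y) (y ^ 2) = m at *
  generalize qPoch (-y) (y ^ 6) = M1 at *
  generalize qPoch (-y ^ 3) (y ^ 6) = M3 at *
  generalize qPoch (-y ^ 5) (y ^ 6) = M5 at *
  generalize qPoch (y ^ 3) (y ^ 6) = U at *
  linear_combination M5 * M1 * e4 * O3 * O1 * a7 - e12 * M5 * M1 * e4 * O3 * O1 * a6 -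
    U * e12 * e4 * O3 * O1 * a2 - U * e12 * e4 * m * a1 + U * e12 * e4 * a3 - U * e12 * a4 +
    e2 * e12 * a5

lemma theta_mul_theta_eq_eulerProd {r : ℝ} (hr0 : 0 < r) (hr : r < 1) :
    theta (r ^ 5) (-(r ^ 3)⁻¹) * theta (r ^ 5) (-r⁻¹) =
      qPoch (r ^ 2) (r ^ 2) * qPoch (r ^ 10) (r ^ 10) := by
  have hr' : |r| < 1 := by rwa [abs_of_pos hr0]
  have h2 : |r ^ 2| < 1 := abs_pow_lt_one hr' (by norm_num)
  have h5 : |r ^ 5| < 1 := abs_pow_lt_one hr' (by norm_num)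
  rw [theta_eq_qPoch (by positivity) h5 (neg_ne_zero.2 (by positivity)),
    theta_eq_qPoch (by positivity) h5 (neg_ne_zero.2 (by positivity))]
  have a1 := qPoch_split (r ^ 2) h2 (m := 5) (by norm_num)
  simp only [prod_range_succ, range_zero, prod_empty] at a1
  have i1 : -(-(r ^ 3)⁻¹ * r ^ 5) = r ^ 2 := by field_simp
  have i2 : -((-(r ^ 3)⁻¹)⁻¹ * r ^ 5) = r ^ 8 := by field_simp
  have i3 : -(-r⁻¹ * r ^ 5) = r ^ 4 := by field_simp
  have i4 : -((-r⁻¹)⁻¹ * r ^ 5) = r ^ 6 := by field_simp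
  rw [i1, i2, i3, i4]
  ring_nf at *
  rw [a1]
  ring

/-! ### Signed theta series and double sums -/

/-- The signed power `(-1)^e r^a`. -/
noncomputable def signedPow (r : ℝ) (e a : ℤ) : ℝ := (-1) ^ e * r ^ a

/-- The theta series `Σ_{n ∈ ℤ} (-1)^(s n) r^(a n² + b n)`. -/
noncomputable def signedTheta (r : ℝ) (s a b : ℤ) : ℝ :=
  ∑' n : ℤ, signedPow r (s * n) (a * n ^ 2 + b * n)

/-- The general term of a product of two signed theta series. -/
noncomputable def doubleTerm (r : ℝ) (s a b t c d : ℤ) (p : ℤ × ℤ) : ℝ :=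
  signedPow r (s * p.1 + t * p.2) (a * p.1 ^ 2 + b * p.1 + (c * p.2 ^ 2 + d * p.2))

lemma signedPow_mul {r : ℝ} (hr : r ≠ 0) (e e' a a' : ℤ) :
    signedPow r e a * signedPow r e' a' = signedPow r (e + e') (a + a') := by
  simp only [signedPow, zpow_add₀ hr, zpow_add₀ (neg_ne_zero.2 one_ne_zero : (-1 : ℝ) ≠ 0)]
  ring

lemma pow_eq_signedPow (r : ℝ) (n : ℕ) : r ^ n = signedPow r 0 n := by
  simp [signedPow]

lemma signedPow_congr (r : ℝ) {e e' a a' : ℤ} (k : ℤ) (he : e = e' + 2 * k) (ha : a = a') :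
    signedPow r e a = signedPow r e' a' := by
  subst he ha
  simp [signedPow, zpow_add₀, zpow_mul]

lemma signedPow_one_add (r : ℝ) (e a : ℤ) : signedPow r (1 + e) a = -signedPow r e a := by
  simp [signedPow, zpow_add₀]

lemma signedPow_congr_neg (r : ℝ) {e e' a a' : ℤ} (k : ℤ) (he : e = e' + 2 * k + 1) (ha : a = a') :
    signedPow r e a = -signedPow r e' a' := by
  rw [← signedPow_one_add]
  exact signedPow_congr r k (by rw [he]; ring) ha

lemma theta_term_eq {r : ℝ} (hr : r ≠ 0) (s a b n : ℤ) :
    (r ^ a) ^ (n ^ 2) * ((-1) ^ s * r ^ b) ^ n = signedPow r (s * n) (a * n ^ 2 + b * n) := by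
  simp only [signedPow, mul_zpow, zpow_add₀ hr, zpow_mul]
  ring

lemma theta_eq_signedTheta {r : ℝ} (hr : r ≠ 0) (s a b : ℤ) :
    theta (r ^ a) ((-1) ^ s * r ^ b) = signedTheta r s a b :=
  tsum_congr fun n => theta_term_eq hr s a b n

lemma summable_signedTheta {r : ℝ} (hr0 : r ≠ 0) (hr : |r| < 1) (s : ℤ) {a : ℤ} (ha : 0 < a)
    (b : ℤ) : Summable fun n : ℤ => signedPow r (s * n) (a * n ^ 2 + b * n) := by
  lift a to ℕ using ha.le
  have ha' : a ≠ 0 := by rintro rfl; simp at ha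
  have h := summable_theta (x := r ^ (a : ℤ)) (w := (-1) ^ s * r ^ b) (zpow_ne_zero _ hr0)
    (by rw [zpow_natCast, abs_pow]; exact pow_lt_one₀ (abs_nonneg r) hr ha')
    (mul_ne_zero (zpow_ne_zero _ (by norm_num)) (zpow_ne_zero _ hr0))
  exact h.congr fun n => theta_term_eq hr0 s a b n

lemma signedTheta_neg (r : ℝ) (s a b : ℤ) : signedTheta r s a (-b) = signedTheta r s a b := by
  unfold signedTheta
  rw [← (Equiv.neg ℤ).tsum_eq]
  refine tsum_congr fun n => signedPow_congr r (-(s * n)) ?_ ?_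
  · simp only [Equiv.neg_apply]; ring
  · simp only [Equiv.neg_apply]; ring

lemma signedTheta_one_self (r : ℝ) (a : ℤ) : signedTheta r 1 a a = 0 := by
  have h : signedTheta r 1 a a = -signedTheta r 1 a a := by
    conv_lhs => rw [signedTheta, ← (Equiv.subLeft (-1 : ℤ)).tsum_eq]
    rw [signedTheta, ← tsum_neg]
    refine tsum_congr fun n => signedPow_congr_neg r (-1 - n) ?_ ?_ <;> simp <;> ring
  linarith

lemma hasSum_doubleTerm {r : ℝ} (hr0 : r ≠ 0) (hr : |r| < 1) (s : ℤ) {a : ℤ} (ha : 0 < a) (b : ℤ)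
    (t : ℤ) {c : ℤ} (hc : 0 < c) (d : ℤ) :
    HasSum (doubleTerm r s a b t c d) (signedTheta r s a b * signedTheta r t c d) := by
  have h1 := summable_signedTheta hr0 hr s ha b
  have h2 := summable_signedTheta hr0 hr t hc d
  have h3 := summable_mul_of_summable_norm h1.norm h2.norm
  refine (h1.hasSum.mul h2.hasSum h3).congr_fun ?_
  intro p
  simp only [doubleTerm, signedPow_mul hr0]

/-- If the images of the injections `i` and `j` partition the index set, a sum splits in two. -/
lemma HasSum.eq_add_tsum {α β γ : Type*} {f : α → ℝ} {S : ℝ} (hf : HasSum f S) {i : β → α}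
    {j : γ → α} (hi : Function.Injective i) (hj : Function.Injective j)
    (hij : ∀ b c, i b ≠ j c) (h : ∀ a, (∃ b, i b = a) ∨ ∃ c, j c = a) :
    S = ∑' b, f (i b) + ∑' c, f (j c) := by
  have hc : IsCompl (Set.range i) (Set.range j) := by
    refine ⟨Set.disjoint_left.2 ?_, codisjoint_iff_le_sup.2 ?_⟩
    · rintro _ ⟨b, rfl⟩ ⟨c, hc⟩
      exact hij b c hc.symm
    · intro a _
      exact h a
  have h1 := (hi.hasSum_range_iff (f := f)).2 (hf.summable.comp_injective hi).hasSum
  have h2 := (hj.hasSum_range_iff (f := f)).2 (hf.summable.comp_injective hj).hasSum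
  exact hf.unique (h1.add_isCompl hc h2)

lemma signedTheta_mul_signedTheta {r : ℝ} (hr0 : r ≠ 0) (hr : |r| < 1) (s t : ℤ) {a : ℤ}
    (ha : 0 < a) (b d : ℤ) :
    signedTheta r s a b * signedTheta r t a d =
      signedTheta r (s + t) (2 * a) (b + d) * signedTheta r (s + t) (2 * a) (b - d) +
      signedPow r s (a + b) * (signedTheta r (s + t) (2 * a) (2 * a + b + d) *
        signedTheta r (s + t) (2 * a) (2 * a + b - d)) := by
  have ha' : 0 < 2 * a := by omega
  rw [(hasSum_doubleTerm hr0 hr s ha b t ha d).eq_add_tsum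
    (i := fun p : ℤ × ℤ => (p.1 + p.2, p.1 - p.2))
    (j := fun p : ℤ × ℤ => (p.1 + p.2 + 1, p.1 - p.2))]
  · rw [← (hasSum_doubleTerm hr0 hr (s + t) ha' (b + d) (s + t) ha' (b - d)).tsum_eq,
      ← (hasSum_doubleTerm hr0 hr (s + t) ha' (2 * a + b + d) (s + t) ha' (2 * a + b - d)).tsum_eq,
      ← tsum_mul_left]
    congr 1
    · refine tsum_congr fun p => signedPow_congr r (-(t * p.2)) ?_ ?_
      · ring
      · ring
    · refine tsum_congr fun p => ?_
      rw [doubleTerm, doubleTerm, signedPow_mul hr0]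
      refine signedPow_congr r (-(t * p.2)) ?_ ?_
      · ring
      · ring
  · rintro ⟨x, y⟩ ⟨u, v⟩ h
    simp only [Prod.mk.injEq] at h ⊢
    omega
  · rintro ⟨x, y⟩ ⟨u, v⟩ h
    simp only [Prod.mk.injEq] at h ⊢
    omega
  · rintro ⟨x, y⟩ ⟨u, v⟩ h
    simp only [Prod.mk.injEq] at h
    omega
  · rintro ⟨x, y⟩
    rcases Int.even_or_odd (x + y) with h | h
    · refine .inl ⟨((x + y) / 2, (x - y) / 2), Prod.ext ?_ ?_⟩ <;> grind
    · refine .inr ⟨((x + y) / 2, (x - y) / 2), Prod.ext ?_ ?_⟩ <;> grind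

/-- The sum of the numerators of the two minimal model characters,
`Σ_k (q^(30k²+k) - q^(30k²+11k+1) + q^(30k²-19k+3) - q^(30k²+31k+8))`, where `q = r²`. -/
noncomputable def branching (r : ℝ) : ℝ :=
  signedTheta r 1 15 1 - r ^ 2 * signedTheta r 1 15 11

lemma signedTheta_mul_branching {r : ℝ} (hr0 : r ≠ 0) (hr : |r| < 1) :
    signedTheta r 1 5 (-3) * branching r =
      signedTheta r 0 15 5 * signedTheta r 0 5 (-1) -
      r ^ 2 * (signedTheta r 0 15 10 * signedTheta r 0 5 4 +
        signedTheta r 1 15 10 * signedTheta r 1 5 4) := by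
  have e1 := (hasSum_doubleTerm hr0 hr 1 (a := 5) (by norm_num) (-3) 1 (c := 15)
    (by norm_num) 1).eq_add_tsum
    (i := fun p : ℤ × ℤ => (2 * p.1 - 3 * p.2, p.2))
    (j := fun p : ℤ × ℤ => (2 * p.1 + 1 - 3 * p.2, p.2))
    (by rintro ⟨x, y⟩ ⟨u, v⟩ h; simp only [Prod.mk.injEq] at h ⊢; omega)
    (by rintro ⟨x, y⟩ ⟨u, v⟩ h; simp only [Prod.mk.injEq] at h ⊢; omega)
    (by rintro ⟨x, y⟩ ⟨u, v⟩ h; simp only [Prod.mk.injEq] at h; omega)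
    (by
      rintro ⟨x, y⟩
      rcases Int.even_or_odd (x + y) with h | h
      · refine .inl ⟨((x + 3 * y) / 2, y), Prod.ext ?_ ?_⟩ <;> grind
      · refine .inr ⟨((x + 3 * y) / 2, y), Prod.ext ?_ ?_⟩ <;> grind)
  have e2 := (hasSum_doubleTerm hr0 hr 1 (a := 5) (by norm_num) (-3) 1 (c := 15)
    (by norm_num) 11).eq_add_tsum
    (i := fun p : ℤ × ℤ => (2 * p.1 - 1 - 3 * p.2, p.2))
    (j := fun p : ℤ × ℤ => (2 * p.1 - 3 * p.2, p.2))
    (by rintro ⟨x, y⟩ ⟨u, v⟩ h; simp only [Prod.mk.injEq] at h ⊢; omega)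
    (by rintro ⟨x, y⟩ ⟨u, v⟩ h; simp only [Prod.mk.injEq] at h ⊢; omega)
    (by rintro ⟨x, y⟩ ⟨u, v⟩ h; simp only [Prod.mk.injEq] at h; omega)
    (by
      rintro ⟨x, y⟩
      rcases Int.even_or_odd (x + y) with h | h
      · refine .inr ⟨((x + 3 * y) / 2, y), Prod.ext ?_ ?_⟩ <;> grind
      · refine .inl ⟨((x + 1 + 3 * y) / 2, y), Prod.ext ?_ ?_⟩ <;> grind)
  have e3 := (hasSum_doubleTerm hr0 hr 0 (a := 15) (by norm_num) 5 0 (c := 5)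
    (by norm_num) (-1)).eq_add_tsum
    (i := fun p : ℤ × ℤ => (2 * p.2 - p.1, p.1))
    (j := fun p : ℤ × ℤ => (p.1 - 1 - 2 * p.2, p.1))
    (by rintro ⟨x, y⟩ ⟨u, v⟩ h; simp only [Prod.mk.injEq] at h ⊢; omega)
    (by rintro ⟨x, y⟩ ⟨u, v⟩ h; simp only [Prod.mk.injEq] at h ⊢; omega)
    (by rintro ⟨x, y⟩ ⟨u, v⟩ h; simp only [Prod.mk.injEq] at h; omega)
    (by
      rintro ⟨x, y⟩
      rcases Int.even_or_odd (x + y) with h | h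
      · refine .inl ⟨(y, (x + y) / 2), Prod.ext ?_ ?_⟩ <;> grind
      · refine .inr ⟨(y, (y - 1 - x) / 2), Prod.ext ?_ ?_⟩ <;> grind)
  have e4 := (hasSum_doubleTerm hr0 hr 0 (a := 15) (by norm_num) 10 0 (c := 5)
    (by norm_num) 4).eq_add_tsum
    (i := fun p : ℤ × ℤ => (p.1 - 2 * p.2, p.1))
    (j := fun p : ℤ × ℤ => (p.1 - 2 * p.2 + 1, p.1))
    (by rintro ⟨x, y⟩ ⟨u, v⟩ h; simp only [Prod.mk.injEq] at h ⊢; omega)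
    (by rintro ⟨x, y⟩ ⟨u, v⟩ h; simp only [Prod.mk.injEq] at h ⊢; omega)
    (by rintro ⟨x, y⟩ ⟨u, v⟩ h; simp only [Prod.mk.injEq] at h; omega)
    (by
      rintro ⟨x, y⟩
      rcases Int.even_or_odd (x + y) with h | h
      · refine .inl ⟨(y, (y - x) / 2), Prod.ext ?_ ?_⟩ <;> grind
      · refine .inr ⟨(y, (y + 1 - x) / 2), Prod.ext ?_ ?_⟩ <;> grind)
  have e5 := (hasSum_doubleTerm hr0 hr 1 (a := 15) (by norm_num) 10 1 (c := 5)
    (by norm_num) 4).eq_add_tsum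
    (i := fun p : ℤ × ℤ => (2 * p.2 - p.1, p.1))
    (j := fun p : ℤ × ℤ => (p.1 - 2 * p.2 + 1, p.1))
    (by rintro ⟨x, y⟩ ⟨u, v⟩ h; simp only [Prod.mk.injEq] at h ⊢; omega)
    (by rintro ⟨x, y⟩ ⟨u, v⟩ h; simp only [Prod.mk.injEq] at h ⊢; omega)
    (by rintro ⟨x, y⟩ ⟨u, v⟩ h; simp only [Prod.mk.injEq] at h; omega)
    (by
      rintro ⟨x, y⟩
      rcases Int.even_or_odd (x + y) with h | h
      · refine .inl ⟨(y, (y + x) / 2), Prod.ext ?_ ?_⟩ <;> grind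
      · refine .inr ⟨(y, (y + 1 - x) / 2), Prod.ext ?_ ?_⟩ <;> grind)
  have f1 : ∑' p : ℤ × ℤ, doubleTerm r 1 5 (-3) 1 15 1 (2 * p.1 - 3 * p.2, p.2) =
      ∑' p : ℤ × ℤ, doubleTerm r 0 15 5 0 5 (-1) (2 * p.2 - p.1, p.1) :=
    tsum_congr fun p => signedPow_congr r (p.1 - p.2) (by ring) (by ring)
  have f2 : r ^ 2 * ∑' p : ℤ × ℤ, doubleTerm r 1 5 (-3) 1 15 11 (2 * p.1 - 1 - 3 * p.2, p.2) =
      -∑' p : ℤ × ℤ, doubleTerm r 0 15 5 0 5 (-1) (p.1 - 1 - 2 * p.2, p.1) := by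
    rw [← tsum_mul_left, ← tsum_neg]
    refine tsum_congr fun p => ?_
    rw [pow_eq_signedPow r 2, doubleTerm, signedPow_mul hr0]
    exact signedPow_congr_neg r (p.1 - p.2 - 1) (by ring) (by ring)
  have f3 : ∑' p : ℤ × ℤ, doubleTerm r 1 5 (-3) 1 15 1 (2 * p.1 + 1 - 3 * p.2, p.2) =
      -(r ^ 2 * ∑' p : ℤ × ℤ, doubleTerm r 0 15 10 0 5 4 (p.1 - 2 * p.2, p.1)) := by
    rw [← tsum_mul_left, ← tsum_neg]
    refine tsum_congr fun p => ?_
    rw [pow_eq_signedPow r 2, doubleTerm, doubleTerm, signedPow_mul hr0]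
    exact signedPow_congr_neg r (p.1 - p.2) (by ring) (by ring)
  have f4 : ∑' p : ℤ × ℤ, doubleTerm r 1 5 (-3) 1 15 11 (2 * p.1 - 3 * p.2, p.2) =
      ∑' p : ℤ × ℤ, doubleTerm r 1 15 10 1 5 4 (2 * p.2 - p.1, p.1) := by
    refine tsum_congr fun p => ?_
    exact signedPow_congr r (p.1 - 2 * p.2) (by ring) (by ring)
  have f5 : ∑' p : ℤ × ℤ, doubleTerm r 1 15 10 1 5 4 (p.1 - 2 * p.2 + 1, p.1) =
      -∑' p : ℤ × ℤ, doubleTerm r 0 15 10 0 5 4 (p.1 - 2 * p.2 + 1, p.1) := by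
    rw [← tsum_neg]
    refine tsum_congr fun p => ?_
    exact signedPow_congr_neg r (p.1 - p.2) (by ring) (by ring)
  rw [branching]
  linear_combination e1 - r ^ 2 * e2 - e3 + r ^ 2 * e4 + r ^ 2 * e5 + f1 - f2 + f3 - r ^ 2 * f4 +
    r ^ 2 * f5

lemma signedTheta_two (r : ℝ) (a b : ℤ) : signedTheta r 2 a b = signedTheta r 0 a b :=
  tsum_congr fun n => signedPow_congr r n (by ring) rfl

lemma qPoch_mul_branching {r : ℝ} (hr0 : 0 < r) (hr : r < 1) :
    qPoch (r ^ 2) (r ^ 2) * branching r =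
      signedTheta r 1 30 0 * signedTheta r 1 10 (-2) -
      r ^ 2 * (signedTheta r 1 30 15 * signedTheta r 1 10 3 +
        signedTheta r 0 30 15 * signedTheta r 0 10 3) +
      r ^ 6 * (signedTheta r 1 30 15 * signedTheta r 1 10 13 +
        signedTheta r 0 30 15 * signedTheta r 0 10 13) := by
  have hr' : |r| < 1 := by rwa [abs_of_pos hr0]
  have h5 : |r ^ 5| < 1 := abs_pow_lt_one hr' (by norm_num)
  have h10 : |r ^ 10| < 1 := abs_pow_lt_one hr' (by norm_num)
  have hne : r ≠ 0 := hr0.ne'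
  have hp : qPoch (r ^ 10) (r ^ 10) ≠ 0 := qPoch_ne_zero h10 h10
  have t0 (a b : ℤ) : theta (r ^ a) (r ^ b) = signedTheta r 0 a b := by
    simpa using theta_eq_signedTheta hne 0 a b
  have t1 (a b : ℤ) : theta (r ^ a) (-r ^ b) = signedTheta r 1 a b := by
    simpa using theta_eq_signedTheta hne 1 a b
  have c1 : theta (-r ^ 15) (r ^ 10) = theta (r ^ 15) (-r ^ 10) := by
    refine tsum_congr fun n => ?_
    have : (-1 : ℝ) ^ (n ^ 2) = (-1) ^ n := by
      rcases Int.even_or_odd n with h | h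
      · rw [h.neg_one_zpow, (h.pow_of_ne_zero two_ne_zero).neg_one_zpow]
      · rw [h.neg_one_zpow, h.pow.neg_one_zpow]
    rw [neg_eq_neg_one_mul, mul_zpow, this, neg_eq_neg_one_mul (r ^ 10), mul_zpow]
    ring
  have g : signedTheta r 1 5 (-3) * signedTheta r 1 5 (-1) =
      qPoch (r ^ 2) (r ^ 2) * qPoch (r ^ 10) (r ^ 10) := by
    rw [← t1, ← t1]
    simpa only [zpow_neg, zpow_ofNat, pow_one] using theta_mul_theta_eq_eulerProd hr0 hr
  have g1 : qPoch (r ^ 10) (r ^ 10) * signedTheta r 1 30 0 =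
      signedTheta r 0 15 5 * signedTheta r 1 10 0 := by
    rw [← t0, ← t1, ← t1]
    simpa only [← pow_mul, zpow_ofNat, pow_zero, Nat.reduceMul] using
      qPoch_mul_theta_neg_one (pow_ne_zero 5 hne) h5
  have g2 : signedTheta r 0 15 10 * signedTheta r 1 10 5 =
      qPoch (r ^ 10) (r ^ 10) * signedTheta r 1 30 15 := by
    rw [← t0, ← t1, ← t1]
    simpa only [← pow_mul, zpow_ofNat, Nat.reduceMul] using
      theta_mul_theta_eq_qPoch_mul_theta (pow_ne_zero 5 hne) h5
  have g3 : signedTheta r 1 15 10 * signedTheta r 0 10 5 =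
      qPoch (r ^ 10) (r ^ 10) * signedTheta r 0 30 15 := by
    rw [← t0, ← t0, ← t1]
    have h := theta_mul_theta_eq_qPoch_mul_theta (neg_ne_zero.2 (pow_ne_zero 5 hne))
      (by rwa [abs_neg])
    rw [(by ring : (-r ^ 5) ^ 3 = -r ^ 15), (by ring : (-r ^ 5) ^ 2 = r ^ 10),
      (by ring : (-r ^ 5) ^ 6 = r ^ 30), neg_neg, neg_neg, c1] at h
    simpa only [zpow_ofNat] using h
  have s1 := signedTheta_mul_signedTheta hne hr' 1 0 (a := 5) (by norm_num) (-1) (-1)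
  have s2 := signedTheta_mul_signedTheta hne hr' 1 0 (a := 5) (by norm_num) (-1) 4
  have s3 := signedTheta_mul_signedTheta hne hr' 1 1 (a := 5) (by norm_num) (-1) 4
  norm_num [signedTheta_one_self, signedTheta_two, signedTheta_neg r _ 10 2,
    signedTheta_neg r _ 10 5, signedPow] at s1 s2 s3
  have b := signedTheta_mul_branching hne hr'
  refine mul_right_cancel₀ hp ?_
  rw [signedTheta_neg r 1 10 2]
  linear_combination -branching r * g + signedTheta r 1 5 (-1) * b - signedTheta r 1 10 2 * g1 +
    signedTheta r 0 15 5 * s1 - r ^ 2 * signedTheta r 0 15 10 * s2 -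
    r ^ 2 * signedTheta r 1 15 10 * s3 -
    r ^ 2 * (signedTheta r 1 10 3 - r ^ 4 * signedTheta r 1 10 13) * g2 -
    r ^ 2 * (signedTheta r 0 10 3 - r ^ 4 * signedTheta r 0 10 13) * g3

/-- The general term of the numerator of the affine W-algebra character. -/
noncomputable def weylTerm (r : ℝ) (p : ℤ × ℤ) : ℝ :=
  doubleTerm r 1 30 0 1 10 (-2) (p.2 - p.1, -(p.1 + p.2)) +
  doubleTerm r 1 30 0 1 10 (-2) (p.2 - p.1, 1 - (p.1 + p.2)) -
  r ^ 2 * (doubleTerm r 1 30 15 1 10 3 (p.1 - p.2, -(p.1 + p.2)) +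
    doubleTerm r 0 30 15 0 10 3 (p.2 - p.1, -(p.1 + p.2))) +
  r ^ 6 * (doubleTerm r 1 30 15 1 10 13 (p.1 - p.2, -(p.1 + p.2)) +
    doubleTerm r 0 30 15 0 10 13 (p.2 - p.1, -(p.1 + p.2)))

lemma injective_sub_neg_add :
    Function.Injective fun p : ℤ × ℤ => (p.2 - p.1, -(p.1 + p.2)) := by
  rintro ⟨x, y⟩ ⟨u, v⟩ h
  simp only [Prod.mk.injEq] at h ⊢
  omega

lemma injective_sub_swap_neg_add :
    Function.Injective fun p : ℤ × ℤ => (p.1 - p.2, -(p.1 + p.2)) := by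
  rintro ⟨x, y⟩ ⟨u, v⟩ h
  simp only [Prod.mk.injEq] at h ⊢
  omega

lemma injective_sub_one_sub_add :
    Function.Injective fun p : ℤ × ℤ => (p.2 - p.1, 1 - (p.1 + p.2)) := by
  rintro ⟨x, y⟩ ⟨u, v⟩ h
  simp only [Prod.mk.injEq] at h ⊢
  omega

lemma HasSum.eq_add_tsum_sub_add {f : ℤ × ℤ → ℝ} {S : ℝ} (hf : HasSum f S) :
    S = ∑' p : ℤ × ℤ, f (p.2 - p.1, -(p.1 + p.2)) +
      ∑' p : ℤ × ℤ, f (p.2 - p.1, 1 - (p.1 + p.2)) := by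
  refine hf.eq_add_tsum injective_sub_neg_add injective_sub_one_sub_add ?_ ?_
  · rintro ⟨x, y⟩ ⟨u, v⟩ h
    simp only [Prod.mk.injEq] at h
    omega
  · rintro ⟨x, y⟩
    rcases Int.even_or_odd (x + y) with h | h
    · refine .inl ⟨(-(x + y) / 2, (x - y) / 2), Prod.ext ?_ ?_⟩ <;> grind
    · refine .inr ⟨((1 - (x + y)) / 2, (1 + x - y) / 2), Prod.ext ?_ ?_⟩ <;> grind

lemma HasSum.eq_add_tsum_sub_swap_add {f : ℤ × ℤ → ℝ} {S : ℝ} (hf : HasSum f S) :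
    S = ∑' p : ℤ × ℤ, f (p.1 - p.2, -(p.1 + p.2)) +
      ∑' p : ℤ × ℤ, f (p.2 - p.1, 1 - (p.1 + p.2)) := by
  rw [hf.eq_add_tsum_sub_add, ← (Equiv.prodComm ℤ ℤ).tsum_eq]
  simp [add_comm]

lemma hasSum_weylTerm {r : ℝ} (hr0 : 0 < r) (hr : r < 1) :
    HasSum (weylTerm r) (qPoch (r ^ 2) (r ^ 2) * branching r) := by
  have hr' : |r| < 1 := by rwa [abs_of_pos hr0]
  have key (s : ℤ) {b : ℤ} (d : ℤ) := hasSum_doubleTerm hr0.ne' hr' s (a := 30) (by norm_num) b s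
    (c := 10) (by norm_num) d
  have hcancel (d : ℤ) : ∑' p : ℤ × ℤ, doubleTerm r 1 30 15 1 10 d (p.2 - p.1, 1 - (p.1 + p.2)) =
      -∑' p : ℤ × ℤ, doubleTerm r 0 30 15 0 10 d (p.2 - p.1, 1 - (p.1 + p.2)) := by
    rw [← tsum_neg]
    refine tsum_congr fun p => signedPow_congr_neg r (-p.1) ?_ ?_
    · ring
    · ring
  have hadd (d : ℤ) : HasSum (fun p : ℤ × ℤ =>
      doubleTerm r 1 30 15 1 10 d (p.1 - p.2, -(p.1 + p.2)) +
        doubleTerm r 0 30 15 0 10 d (p.2 - p.1, -(p.1 + p.2)))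
      (signedTheta r 1 30 15 * signedTheta r 1 10 d +
        signedTheta r 0 30 15 * signedTheta r 0 10 d) := by
    have h1 := ((key 1 (b := 15) d).summable.comp_injective injective_sub_swap_neg_add).hasSum.add
      ((key 0 (b := 15) d).summable.comp_injective injective_sub_neg_add).hasSum
    rw [(key 1 (b := 15) d).eq_add_tsum_sub_swap_add, (key 0 (b := 15) d).eq_add_tsum_sub_add,
      hcancel d, add_add_add_comm, neg_add_cancel, add_zero]
    exact h1
  have h0 : HasSum (fun p : ℤ × ℤ =>
      doubleTerm r 1 30 0 1 10 (-2) (p.2 - p.1, -(p.1 + p.2)) +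
        doubleTerm r 1 30 0 1 10 (-2) (p.2 - p.1, 1 - (p.1 + p.2)))
      (signedTheta r 1 30 0 * signedTheta r 1 10 (-2)) := by
    have h1 := ((key 1 (b := 0) (-2)).summable.comp_injective injective_sub_neg_add).hasSum.add
      ((key 1 (b := 0) (-2)).summable.comp_injective injective_sub_one_sub_add).hasSum
    rw [(key 1 (b := 0) (-2)).eq_add_tsum_sub_add]
    exact h1
  rw [qPoch_mul_branching hr0 hr]
  exact (h0.sub ((hadd 3).mul_left _)).add ((hadd 13).mul_left _)

lemma sum_weyl_eq {r : ℝ} (hr0 : 0 < r) (m n : ℤ) :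
    ∑ p ∈ ({((1 : ℤ), (1 : ℤ), (1 : ℤ)), (0, 1, -1), (1, 0, -1),
                  (-1, 0, 1), (0, -1, 1), (-1, -1, -1)} : Finset (ℤ × ℤ × ℤ)),
            (p.2.2 : ℝ) *
              (r ^ 2) ^ (((rootQ (5 * p.1 + 20 * n - 4) (5 * p.2.1 + 20 * m - 4) : ℤ) : ℝ) / 40) =
      (r ^ 2) ^ ((1 : ℝ) / 20) * weylTerm r (m, n) := by
  have key (Q e : ℤ) (h : Q = 2 + 20 * e) :
      (r ^ 2) ^ ((Q : ℝ) / 40) = (r ^ 2) ^ ((1 : ℝ) / 20) * r ^ e := by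
    rw [← Real.rpow_natCast r 2, ← Real.rpow_mul hr0.le, ← Real.rpow_mul hr0.le,
      ← Real.rpow_intCast, ← Real.rpow_add hr0, h]
    congr 1
    push_cast
    ring
  have hpos (e : ℤ) : r ^ e = signedPow r 0 e := by simp [signedPow]
  rw [sum_insert (by decide), sum_insert (by decide), sum_insert (by decide),
    sum_insert (by decide), sum_insert (by decide), sum_singleton]
  dsimp only
  rw [key (rootQ (5 * 1 + 20 * n - 4) (5 * 1 + 20 * m - 4))
      (40 * (n ^ 2 - n * m + m ^ 2) + 2 * n + 2 * m) (by rw [rootQ]; ring),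
    key (rootQ (5 * 0 + 20 * n - 4) (5 * 1 + 20 * m - 4))
      (40 * (n ^ 2 - n * m + m ^ 2) - 18 * n + 12 * m + 2) (by rw [rootQ]; ring),
    key (rootQ (5 * 1 + 20 * n - 4) (5 * 0 + 20 * m - 4))
      (40 * (n ^ 2 - n * m + m ^ 2) - 18 * m + 12 * n + 2) (by rw [rootQ]; ring),
    key (rootQ (5 * -1 + 20 * n - 4) (5 * 0 + 20 * m - 4))
      (40 * (n ^ 2 - n * m + m ^ 2) - 28 * n + 2 * m + 6) (by rw [rootQ]; ring),
    key (rootQ (5 * 0 + 20 * n - 4) (5 * -1 + 20 * m - 4))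
      (40 * (n ^ 2 - n * m + m ^ 2) - 28 * m + 2 * n + 6) (by rw [rootQ]; ring),
    key (rootQ (5 * -1 + 20 * n - 4) (5 * -1 + 20 * m - 4))
      (40 * (n ^ 2 - n * m + m ^ 2) - 18 * n - 18 * m + 8) (by rw [rootQ]; ring)]
  have f1 : doubleTerm r 1 30 0 1 10 (-2) (n - m, -(m + n)) =
      r ^ (40 * (n ^ 2 - n * m + m ^ 2) + 2 * n + 2 * m) := by
    rw [hpos]
    exact signedPow_congr r (-m) (by ring) (by ring)
  have f2 : doubleTerm r 1 30 0 1 10 (-2) (n - m, 1 - (m + n)) =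
      -r ^ (40 * (n ^ 2 - n * m + m ^ 2) - 18 * n - 18 * m + 8) := by
    rw [hpos]
    exact signedPow_congr_neg r (-m) (by ring) (by ring)
  have f3 : r ^ 2 * doubleTerm r 1 30 15 1 10 3 (m - n, -(m + n)) =
      r ^ (40 * (n ^ 2 - n * m + m ^ 2) - 18 * n + 12 * m + 2) := by
    rw [hpos, pow_eq_signedPow r 2, doubleTerm, signedPow_mul hr0.ne']
    exact signedPow_congr r (-n) (by ring) (by ring)
  have f4 : r ^ 2 * doubleTerm r 0 30 15 0 10 3 (n - m, -(m + n)) =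
      r ^ (40 * (n ^ 2 - n * m + m ^ 2) - 18 * m + 12 * n + 2) := by
    rw [hpos, pow_eq_signedPow r 2, doubleTerm, signedPow_mul hr0.ne']
    exact signedPow_congr r 0 (by ring) (by ring)
  have f5 : r ^ 6 * doubleTerm r 1 30 15 1 10 13 (m - n, -(m + n)) =
      r ^ (40 * (n ^ 2 - n * m + m ^ 2) - 28 * n + 2 * m + 6) := by
    rw [hpos, pow_eq_signedPow r 6, doubleTerm, signedPow_mul hr0.ne']
    exact signedPow_congr r (-n) (by ring) (by ring)
  have f6 : r ^ 6 * doubleTerm r 0 30 15 0 10 13 (n - m, -(m + n)) =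
      r ^ (40 * (n ^ 2 - n * m + m ^ 2) - 28 * m + 2 * n + 6) := by
    rw [hpos, pow_eq_signedPow r 6, doubleTerm, signedPow_mul hr0.ne']
    exact signedPow_congr r 0 (by ring) (by ring)
  rw [weylTerm]
  push_cast
  linear_combination (r ^ 2) ^ ((1 : ℝ) / 20) * (-f1 - f2 + f3 + f4 - f5 - f6)

lemma tsum_weyl_eq {r : ℝ} (hr0 : 0 < r) (hr : r < 1) :
    ∑' m : ℤ, ∑' n : ℤ, weylTerm r (m, n) = qPoch (r ^ 2) (r ^ 2) * branching r := by
  rw [← (hasSum_weylTerm hr0 hr).tsum_eq, (hasSum_weylTerm hr0 hr).summable.tsum_prod]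

lemma minChar_add_minChar {r : ℝ} (hr0 : 0 < r) (hr : r < 1) :
    minChar 5 6 1 1 (r ^ 2) + minChar 5 6 1 5 (r ^ 2) =
      (r ^ 2) ^ (-(1 : ℝ) / 30) * (eulerProd (r ^ 2))⁻¹ * branching r := by
  have hr' : |r| < 1 := by rwa [abs_of_pos hr0]
  have s1 := summable_signedTheta hr0.ne' hr' 1 (a := 15) (by norm_num) 1
  have s2 := summable_signedTheta hr0.ne' hr' 1 (a := 15) (by norm_num) 11
  have ie : Function.Injective fun k : ℤ => 2 * k := fun a b h => by simpa using h
  have io : Function.Injective fun k : ℤ => 2 * k + 1 := fun a b h => by simpa using h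
  have io' : Function.Injective fun k : ℤ => 2 * k - 1 := fun a b h => by simpa using h
  have b1 := s1.hasSum.eq_add_tsum ie io (by intros; omega)
    (fun a => by rcases Int.even_or_odd' a with ⟨k, h | h⟩ <;> simp [h])
  have b2 := s2.hasSum.eq_add_tsum ie io' (by intros; omega) (fun a => by
    rcases Int.even_or_odd' a with ⟨k, h | h⟩
    · exact .inl ⟨k, h.symm⟩
    · exact .inr ⟨k + 1, by rw [h]; ring⟩)
  have hzpow (e : ℤ) : (r ^ 2) ^ e = signedPow r 0 (2 * e) := by
    simp only [signedPow, zpow_mul, zpow_zero, one_mul]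
    norm_cast
  have t1 : ∑' k : ℤ, (((r ^ 2) ^ (5 * 6 * k ^ 2 + k * (1 * 6 - 1 * 5)) : ℝ) -
      ((r ^ 2) ^ (5 * 6 * k ^ 2 + (1 * 6 + 1 * 5) * k + 1 * 1) : ℝ)) =
      ∑' k : ℤ, signedPow r (1 * (2 * k)) (15 * (2 * k) ^ 2 + 1 * (2 * k)) -
      r ^ 2 * ∑' k : ℤ, signedPow r (1 * (2 * k)) (15 * (2 * k) ^ 2 + 11 * (2 * k)) := by
    refine Eq.trans (tsum_congr fun k => ?_) ((s1.comp_injective ie).hasSum.sub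
      ((s2.comp_injective ie).hasSum.mul_left (r ^ 2))).tsum_eq
    rw [hzpow, hzpow, Function.comp_apply, Function.comp_apply, pow_eq_signedPow r 2,
      signedPow_mul hr0.ne']
    congr 1 <;> refine signedPow_congr r (-k) ?_ ?_ <;> push_cast <;> ring
  have t2 : r ^ 6 * ∑' k : ℤ, (((r ^ 2) ^ (5 * 6 * k ^ 2 + k * (1 * 6 - 5 * 5)) : ℝ) -
      ((r ^ 2) ^ (5 * 6 * k ^ 2 + (1 * 6 + 5 * 5) * k + 1 * 5) : ℝ)) =
      ∑' k : ℤ, signedPow r (1 * (2 * k + 1)) (15 * (2 * k + 1) ^ 2 + 1 * (2 * k + 1)) -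
      r ^ 2 * ∑' k : ℤ, signedPow r (1 * (2 * k - 1)) (15 * (2 * k - 1) ^ 2 + 11 * (2 * k - 1)) := by
    rw [← tsum_mul_left]
    refine Eq.trans (tsum_congr fun k => ?_) ((s1.comp_injective io).hasSum.sub
      ((s2.comp_injective io').hasSum.mul_left (r ^ 2))).tsum_eq
    rw [hzpow, hzpow, Function.comp_apply, Function.comp_apply, mul_sub, pow_eq_signedPow r 2,
      pow_eq_signedPow r 6, signedPow_mul hr0.ne', signedPow_mul hr0.ne', signedPow_mul hr0.ne']
    have u1 : signedPow r (1 * (2 * k + 1)) (15 * (2 * k + 1) ^ 2 + 1 * (2 * k + 1)) =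
        -signedPow r (0 + 0) ((6 : ℕ) + 2 * (5 * 6 * k ^ 2 + (1 * 6 + 5 * 5) * k + 1 * 5)) :=
      signedPow_congr_neg r k (by ring) (by push_cast; ring)
    have u2 : signedPow r (0 + 1 * (2 * k - 1))
        ((2 : ℕ) + (15 * (2 * k - 1) ^ 2 + 11 * (2 * k - 1))) =
        -signedPow r (0 + 0) ((6 : ℕ) + 2 * (5 * 6 * k ^ 2 + k * (1 * 6 - 5 * 5))) :=
      signedPow_congr_neg r (k - 1) (by ring) (by push_cast; ring)
    rw [u1, u2]
    ring
  have hpre : (r ^ 2) ^ ((3 : ℝ) - 1 / 30) = (r ^ 2) ^ (-(1 : ℝ) / 30) * r ^ 6 := by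
    rw [show (3 : ℝ) - 1 / 30 = -1 / 30 + (3 : ℕ) by norm_num, Real.rpow_add (by positivity),
      Real.rpow_natCast]
    ring
  have hx1 : (((((1 * 6 - 1 * 5) ^ 2 - (5 - 6) ^ 2 : ℤ) : ℝ)) / (4 * ((5 : ℤ) : ℝ) * ((6 : ℤ) : ℝ))) -
      (1 - 6 * (((5 : ℤ) : ℝ) - ((6 : ℤ) : ℝ)) ^ 2 / (((5 : ℤ) : ℝ) * ((6 : ℤ) : ℝ))) / 24 =
      -1 / 30 := by norm_num
  have hx2 : (((((1 * 6 - 5 * 5) ^ 2 - (5 - 6) ^ 2 : ℤ) : ℝ)) / (4 * ((5 : ℤ) : ℝ) * ((6 : ℤ) : ℝ))) -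
      (1 - 6 * (((5 : ℤ) : ℝ) - ((6 : ℤ) : ℝ)) ^ 2 / (((5 : ℤ) : ℝ) * ((6 : ℤ) : ℝ))) / 24 =
      3 - 1 / 30 := by norm_num
  have hb : branching r = ∑' k : ℤ, signedPow r (1 * k) (15 * k ^ 2 + 1 * k) -
      r ^ 2 * ∑' k : ℤ, signedPow r (1 * k) (15 * k ^ 2 + 11 * k) := rfl
  rw [minChar, minChar, hx1, hx2, hpre, t1, hb, b1, b2]
  linear_combination (r ^ 2) ^ (-(1 : ℝ) / 30) * (eulerProd (r ^ 2))⁻¹ * t2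

lemma eulerProd_eq_qPoch (q : ℝ) : eulerProd q = qPoch q q :=
  tprod_congr fun i => by rw [pow_succ']

theorem FKW_character_L_four_fifths (q : ℝ) (hq0 : 0 < q) (hq1 : q < 1) :
    q ^ (-(1 : ℝ) / 12) * ((eulerProd q) ^ 2)⁻¹ *
        ∑' m : ℤ, ∑' n : ℤ,
          ∑ p ∈ ({((1 : ℤ), (1 : ℤ), (1 : ℤ)), (0, 1, -1), (1, 0, -1),
                  (-1, 0, 1), (0, -1, 1), (-1, -1, -1)} : Finset (ℤ × ℤ × ℤ)),
            (p.2.2 : ℝ) *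
              q ^ (((rootQ (5 * p.1 + 20 * n - 4) (5 * p.2.1 + 20 * m - 4) : ℤ) : ℝ) / 40) =
      minChar 5 6 1 1 q + minChar 5 6 1 5 q := by
  obtain ⟨r, hr0, rfl⟩ : ∃ r : ℝ, 0 < r ∧ r ^ 2 = q :=
    ⟨Real.sqrt q, Real.sqrt_pos.2 hq0, Real.sq_sqrt hq0.le⟩
  have hr : r < 1 := by nlinarith
  have habs : |r ^ 2| < 1 := by rwa [abs_of_pos hq0]
  have hE : eulerProd (r ^ 2) ≠ 0 := by
    rw [eulerProd_eq_qPoch]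
    exact qPoch_ne_zero habs habs
  have hpre : (r ^ 2) ^ (-(1 : ℝ) / 30) =
      (r ^ 2) ^ (-(1 : ℝ) / 12) * (r ^ 2) ^ ((1 : ℝ) / 20) := by
    rw [← Real.rpow_add hq0]
    norm_num
  simp only [sum_weyl_eq hr0, tsum_mul_left]
  rw [tsum_weyl_eq hr0 hr, minChar_add_minChar hr0 hr, hpre, ← eulerProd_eq_qPoch]
  field_simp
end

section
/- For every real number q with 0 < q < 1: (1 + q^{3/2}) · ∏_{n=1}^∞ (1 − q^{5n})(1 − q^{10n−8})(1 − q^{10n−2})(1 + q^{5n − 3/2})(1 + q^{5n + 3/2}) = (q)_∞ / ∏_{n=0}^∞ ((1 − q^{(5n+2)/2})(1 − q^{(5n+3)/2})). -/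
open scoped BigOperators

open Filter in
/-- An infinite product may be regrouped into consecutive blocks of length `N`. -/
theorem Multipliable.tprod_eq_tprod_prod_range {f : ℕ → ℝ} (hf : Multipliable f) {N : ℕ}
    (hN : 0 < N) (hg : ∀ r, Multipliable fun n ↦ f (N * n + r)) :
    ∏' n, f n = ∏ r ∈ Finset.range N, ∏' n, f (N * n + r) := by
  rw [← Multipliable.tprod_finsetProd fun r _ ↦ hg r]
  have hblock (n : ℕ) : ∏ i ∈ Finset.range (N * n), f i =
      ∏ k ∈ Finset.range n, ∏ r ∈ Finset.range N, f (N * k + r) := by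
    induction n with
    | zero => simp
    | succ n ih => rw [Nat.mul_succ, Finset.prod_range_add, ih, Finset.prod_range_succ]
  refine tendsto_nhds_unique
    (hf.tendsto_prod_tprod_nat.comp (tendsto_id.const_mul_atTop' hN)) ?_
  refine (multipliable_prod fun r _ ↦ hg r).tendsto_prod_tprod_nat.congr fun n ↦ ?_
  exact (hblock n).symm

/-- The product `∏ (1 - x ^ (m n + a))` over the arithmetic progression `a, a + m, a + 2m, …`. -/
noncomputable def progProd (x : ℝ) (m a : ℕ) : ℝ := ∏' n : ℕ, (1 - x ^ (m * n + a))

section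

variable {x : ℝ} {m : ℕ}

theorem summable_pow_prog (h0 : 0 ≤ x) (h1 : x < 1) (hm : 0 < m) (a : ℕ) :
    Summable fun n : ℕ ↦ x ^ (m * n + a) := by
  simp only [pow_add, pow_mul]
  exact (summable_geometric_of_lt_one (by positivity)
    (pow_lt_one₀ h0 h1 hm.ne')).mul_right _

theorem multipliable_one_add_pow_prog (h0 : 0 ≤ x) (h1 : x < 1) (hm : 0 < m) (a : ℕ) :
    Multipliable fun n : ℕ ↦ 1 + x ^ (m * n + a) :=
  Real.multipliable_one_add_of_summable (summable_pow_prog h0 h1 hm a)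

theorem multipliable_one_sub_pow_prog (h0 : 0 ≤ x) (h1 : x < 1) (hm : 0 < m) (a : ℕ) :
    Multipliable fun n : ℕ ↦ 1 - x ^ (m * n + a) := by
  simpa only [sub_eq_add_neg] using
    Real.multipliable_one_add_of_summable (summable_pow_prog h0 h1 hm a).neg

theorem progProd_ne_zero (h0 : 0 ≤ x) (h1 : x < 1) (hm : 0 < m) {a : ℕ} (ha : 0 < a) :
    progProd x m a ≠ 0 := by
  simp only [progProd, sub_eq_add_neg]
  refine tprod_one_add_ne_zero_of_summable (fun n ↦ ?_) (summable_pow_prog h0 h1 hm a).neg.norm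
  have := pow_lt_one₀ h0 h1 (show m * n + a ≠ 0 by omega)
  linarith

/-- Splitting a progression modulo `m` into `N` progressions modulo `N * m`. -/
theorem progProd_eq_prod_range (h0 : 0 ≤ x) (h1 : x < 1) (hm : 0 < m) (a : ℕ) {N : ℕ}
    (hN : 0 < N) :
    progProd x m a = ∏ r ∈ Finset.range N, progProd x (N * m) (m * r + a) := by
  have hexp (n r : ℕ) : m * (N * n + r) + a = N * m * n + (m * r + a) := by ring
  rw [progProd, (multipliable_one_sub_pow_prog h0 h1 hm a).tprod_eq_tprod_prod_range hN]
  · simp only [hexp, progProd]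
  · intro r
    simp only [hexp]
    exact multipliable_one_sub_pow_prog h0 h1 (by positivity) _

theorem tprod_one_add_pow_mul_progProd (h0 : 0 ≤ x) (h1 : x < 1) (hm : 0 < m) (a : ℕ) :
    (∏' n : ℕ, (1 + x ^ (m * n + a))) * progProd x m a = progProd x (2 * m) (2 * a) := by
  rw [progProd, ← (multipliable_one_add_pow_prog h0 h1 hm a).tprod_mul
    (multipliable_one_sub_pow_prog h0 h1 hm a), progProd]
  congr 1
  ext n
  ring

theorem one_add_pow_mul_tprod (h0 : 0 ≤ x) (h1 : x < 1) (hm : 0 < m) (a : ℕ) :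
    (1 + x ^ a) * ∏' n : ℕ, (1 + x ^ (m * n + (m + a))) = ∏' n : ℕ, (1 + x ^ (m * n + a)) := by
  have hexp (n : ℕ) : m * n + (m + a) = m * (n + 1) + a := by ring
  rw [tprod_eq_zero_mul' (f := fun n ↦ 1 + x ^ (m * n + a))]
  · simp [hexp]
  · simpa only [hexp] using multipliable_one_add_pow_prog h0 h1 hm (m + a)

end

theorem quintuple_product_identity_specialized (q : ℝ) (hq0 : 0 < q) (hq1 : q < 1) :
    (1 + q ^ ((3 : ℝ) / 2)) *
        ∏' n : ℕ, ((1 - q ^ (5 * (n + 1))) * (1 - q ^ (10 * (n + 1) - 8)) *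
          (1 - q ^ (10 * (n + 1) - 2)) *
          (1 + q ^ (5 * ((n : ℝ) + 1) - 3 / 2)) * (1 + q ^ (5 * ((n : ℝ) + 1) + 3 / 2))) =
      eulerProd q /
        ∏' n : ℕ, ((1 - q ^ ((5 * (n : ℝ) + 2) / 2)) * (1 - q ^ ((5 * (n : ℝ) + 3) / 2))) := by
  obtain ⟨x, hx0, hx1, rfl⟩ : ∃ x : ℝ, 0 < x ∧ x < 1 ∧ q = x ^ 2 :=
    ⟨√q, Real.sqrt_pos.2 hq0, (Real.sqrt_lt' one_pos).2 (by simpa using hq1),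
      (Real.sq_sqrt hq0.le).symm⟩
  have hpow {y : ℝ} (k : ℕ) (hy : 2 * y = k) : (x ^ 2) ^ y = x ^ k := by
    rw [← Real.rpow_natCast x 2, ← Real.rpow_mul hx0.le, ← Real.rpow_natCast x k, ← hy]
    norm_num
  have hx := hx0.le
  have hmul := fun {m : ℕ} (hm : 0 < m) ↦ multipliable_one_sub_pow_prog hx hx1 hm
  have hadd := fun {m : ℕ} (hm : 0 < m) ↦ multipliable_one_add_pow_prog hx hx1 hm
  have hlhs : (1 + (x ^ 2) ^ ((3 : ℝ) / 2)) *
        ∏' n : ℕ, ((1 - (x ^ 2) ^ (5 * (n + 1))) * (1 - (x ^ 2) ^ (10 * (n + 1) - 8)) *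
          (1 - (x ^ 2) ^ (10 * (n + 1) - 2)) *
          (1 + (x ^ 2) ^ (5 * ((n : ℝ) + 1) - 3 / 2)) *
          (1 + (x ^ 2) ^ (5 * ((n : ℝ) + 1) + 3 / 2))) =
      progProd x 10 10 * progProd x 20 4 * progProd x 20 16 *
        (∏' n : ℕ, (1 + x ^ (10 * n + 7))) * ∏' n : ℕ, (1 + x ^ (10 * n + 3)) := by
    have hterm (n : ℕ) : (1 - (x ^ 2) ^ (5 * (n + 1))) * (1 - (x ^ 2) ^ (10 * (n + 1) - 8)) *
          (1 - (x ^ 2) ^ (10 * (n + 1) - 2)) *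
          (1 + (x ^ 2) ^ (5 * ((n : ℝ) + 1) - 3 / 2)) *
          (1 + (x ^ 2) ^ (5 * ((n : ℝ) + 1) + 3 / 2)) =
        (1 - x ^ (10 * n + 10)) * (1 - x ^ (20 * n + 4)) * (1 - x ^ (20 * n + 16)) *
          (1 + x ^ (10 * n + 7)) * (1 + x ^ (10 * n + (10 + 3))) := by
      rw [hpow (10 * n + 7) (by push_cast; ring), hpow (10 * n + (10 + 3)) (by push_cast; ring),
        ← pow_mul, ← pow_mul, ← pow_mul,
        show 2 * (5 * (n + 1)) = 10 * n + 10 by omega,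
        show 2 * (10 * (n + 1) - 8) = 20 * n + 4 by omega,
        show 2 * (10 * (n + 1) - 2) = 20 * n + 16 by omega]
    have m10 := hmul (m := 10) (by norm_num) 10
    have m4 := hmul (m := 20) (by norm_num) 4
    have m16 := hmul (m := 20) (by norm_num) 16
    have a7 := hadd (m := 10) (by norm_num) 7
    have a13 := hadd (m := 10) (by norm_num) (10 + 3)
    rw [tprod_congr hterm, (((m10.mul m4).mul m16).mul a7).tprod_mul a13,
      ((m10.mul m4).mul m16).tprod_mul a7, (m10.mul m4).tprod_mul m16, m10.tprod_mul m4,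
      ← one_add_pow_mul_tprod hx hx1 (show 0 < 10 by norm_num) 3,
      hpow 3 (by norm_num)]
    simp only [progProd]
    ring
  have heuler : eulerProd (x ^ 2) = progProd x 2 2 := by
    simp only [eulerProd, progProd]
    congr 1
    ext n
    ring
  have hden : ∏' n : ℕ, ((1 - (x ^ 2) ^ ((5 * (n : ℝ) + 2) / 2)) *
      (1 - (x ^ 2) ^ ((5 * (n : ℝ) + 3) / 2))) = progProd x 5 2 * progProd x 5 3 := by
    rw [progProd, progProd, ← (hmul (by norm_num) 2).tprod_mul (hmul (by norm_num) 3)]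
    refine tprod_congr fun n ↦ ?_
    rw [hpow (5 * n + 2) (by push_cast; ring), hpow (5 * n + 3) (by push_cast; ring)]
  have hsplit := fun {m : ℕ} (hm : 0 < m) (a : ℕ) {N : ℕ} (hN : 0 < N) ↦
    progProd_eq_prod_range hx hx1 hm a hN
  have h22 := hsplit (m := 2) (by norm_num) 2 (N := 5) (by norm_num)
  have h52 := hsplit (m := 5) (by norm_num) 2 (N := 2) (by norm_num)
  have h53 := hsplit (m := 5) (by norm_num) 3 (N := 2) (by norm_num)
  have h4 := hsplit (m := 10) (by norm_num) 4 (N := 2) (by norm_num)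
  have h6 := hsplit (m := 10) (by norm_num) 6 (N := 2) (by norm_num)
  have h3 := tprod_one_add_pow_mul_progProd hx hx1 (show 0 < 10 by norm_num) 3
  have h7 := tprod_one_add_pow_mul_progProd hx hx1 (show 0 < 10 by norm_num) 7
  norm_num [Finset.prod_range_succ] at h22 h52 h53 h4 h6 h3 h7
  have hne := fun {a : ℕ} (ha : 0 < a) ↦ progProd_ne_zero hx hx1 (show 0 < 10 by norm_num) ha
  rw [hlhs, heuler, hden, h22, h52, h53, eq_div_iff, h4, h6, ← h3, ← h7]
  · ring
  · simp only [ne_eq, mul_eq_zero, not_or]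
    exact ⟨⟨hne (by norm_num), hne (by norm_num)⟩, hne (by norm_num), hne (by norm_num)⟩
end
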